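/- arXiv:1204.1100 — 2 statements merged into one kernel-verified Lean document; each statement's English description precedes it below -/
import Mathlib

section
/- Let X be a Polish space. Then for a generic (comeager set of) non-empty compact set K ⊆ X, either K is finite or there exists a continuous gauge function h such that 0 < H^h(K) < ∞. -/
open MeasureTheory Filter Set TopologicalSpace

/-- A gauge function: non-decreasing, right-continuous, vanishing exactly at `0`. -/
def IsGauge (h : ENNReal → ENNReal) : Prop :=
  Monotone h ∧ (∀ x, h x = 0 ↔ x = 0) ∧
    ∀ x : ENNReal, Tendsto h (nhdsWithin x (Set.Ioi x)) (nhds (h x))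

/-- A continuous gauge function: a gauge function continuous on `[0, ∞)`. -/
def IsContinuousGauge (h : ENNReal → ENNReal) : Prop :=
  IsGauge h ∧ ContinuousOn h {x : ENNReal | x ≠ ⊤}

/-- The ramp functions used for the gauge. -/
noncomputable def ramp (e N : ℕ → ℝ) (n : ℕ) (t : ℝ) : ℝ :=
  (1 / N n) * max 0 (min 1 ((t - e (n + 1)) / (2 * e (n + 1))))

theorem pow_le_N {N : ℕ → ℝ} (hN : ∀ n, 2 * N n ≤ N (n + 1)) (n j : ℕ) :
    2 ^ j * N n ≤ N (j + n) := by
  induction j with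
  | zero => simp
  | succ j ih =>
    have := hN (j + n)
    rw [show j + 1 + n = j + n + 1 by ring, pow_succ]
    nlinarith

theorem exists_gauge (e N : ℕ → ℝ) (he : ∀ n, 0 < e n) (he3 : ∀ n, 3 * e (n + 1) ≤ e n)
    (hlim : Tendsto e atTop (nhds 0))
    (hNpos : ∀ n, 0 < N n) (hN : ∀ n, 2 * N n ≤ N (n + 1)) :
    ∃ H : ENNReal → ENNReal, IsContinuousGauge H ∧
      (∀ n, H (ENNReal.ofReal (e n)) ≤ ENNReal.ofReal (2 / N n)) ∧
      ∀ n, ENNReal.ofReal (1 / N n) ≤ H (ENNReal.ofReal (3 * e (n + 1))) := by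
  have hr0 : ∀ n t, 0 ≤ ramp e N n t := fun n t => by
    unfold ramp
    have := hNpos n
    positivity
  have hr1 : ∀ n t, ramp e N n t ≤ 1 / N n := fun n t => by
    unfold ramp
    have := hNpos n
    have h1 : max 0 (min 1 ((t - e (n + 1)) / (2 * e (n + 1)))) ≤ 1 :=
      max_le zero_le_one (min_le_left _ _)
    calc _ ≤ (1 / N n) * 1 := by gcongr
      _ = _ := mul_one _
  have hgeo : ∀ n j, 1 / N (j + n) ≤ (1 / N n) * (1 / 2) ^ j := fun n j => by
    have h1 := pow_le_N hN n j
    have h2 := hNpos n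
    have h3 := hNpos (j + n)
    calc 1 / N (j + n) ≤ 1 / (2 ^ j * N n) := by gcongr
      _ = _ := by
        rw [one_div_pow]
        field_simp
  have hsumgeo : ∀ n, Summable fun j => (1 / N n) * ((1 : ℝ) / 2) ^ j :=
    fun n => summable_geometric_two.mul_left _
  have hsum1 : Summable fun n => 1 / N n := by
    refine Summable.of_nonneg_of_le (fun n => ?_) (fun n => ?_) (hsumgeo 0)
    · have := hNpos n
      positivity
    · simpa using hgeo 0 n
  have hsum : ∀ t, Summable fun n => ramp e N n t := fun t =>
    Summable.of_nonneg_of_le (fun n => hr0 n t) (fun n => hr1 n t) hsum1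
  have hmono : ∀ n, Monotone (ramp e N n) := fun n s t hst => by
    unfold ramp
    have := hNpos n
    have := he (n + 1)
    gcongr
  have hcont : ∀ n, Continuous (ramp e N n) := fun n => by
    unfold ramp
    fun_prop
  have hle0 : ∀ n t, t ≤ e (n + 1) → ramp e N n t = 0 := fun n t ht => by
    unfold ramp
    have h1 := he (n + 1)
    have : (t - e (n + 1)) / (2 * e (n + 1)) ≤ 0 :=
      div_nonpos_of_nonpos_of_nonneg (by linarith) (by linarith)
    rw [max_eq_left ((min_le_right _ _).trans this), mul_zero]
  have hge1 : ∀ n, ramp e N n (3 * e (n + 1)) = 1 / N n := fun n => by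
    unfold ramp
    have h1 := he (n + 1)
    have : (3 * e (n + 1) - e (n + 1)) / (2 * e (n + 1)) = 1 := by
      field_simp
      ring
    rw [this]
    simp
  have hpos : ∀ n t, e (n + 1) < t → 0 < ramp e N n t := fun n t ht => by
    unfold ramp
    have h1 := he (n + 1)
    have h2 := hNpos n
    have : 0 < (t - e (n + 1)) / (2 * e (n + 1)) := div_pos (by linarith) (by linarith)
    have : 0 < min 1 ((t - e (n + 1)) / (2 * e (n + 1))) := lt_min one_pos this
    have : 0 < max 0 (min 1 ((t - e (n + 1)) / (2 * e (n + 1)))) := lt_max_of_lt_right this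
    positivity
  have hanti : Antitone e := antitone_nat_of_succ_le fun n => by
    have := he3 n
    have := he (n + 1)
    linarith
  set g : ℝ → ℝ := fun t => ∑' n, ramp e N n t with hg
  have gcont : Continuous g := continuous_tsum hcont hsum1 fun n t => by
    rw [Real.norm_of_nonneg (hr0 n t)]
    exact hr1 n t
  have gmono : Monotone g := fun s t hst =>
    (hsum s).tsum_le_tsum (fun n => hmono n hst) (hsum t)
  have gzero : g 0 = 0 := by
    simp only [hg]
    rw [tsum_congr fun n => hle0 n 0 (he _).le, tsum_zero]
  have gpos : ∀ t, 0 < t → 0 < g t := fun t ht => by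
    obtain ⟨n, hn⟩ := ((hlim.eventually (gt_mem_nhds ht)).and (eventually_ge_atTop 1)).exists
    obtain ⟨m, rfl⟩ : ∃ m, n = m + 1 := ⟨n - 1, by omega⟩
    exact (hsum t).tsum_pos (fun n => hr0 n t) m (hpos m t hn.1)
  set H : ENNReal → ENNReal := fun x => if x = ⊤ then ⊤ else ENNReal.ofReal (g x.toReal) with hH
  have Hof : ∀ t, 0 ≤ t → H (ENNReal.ofReal t) = ENNReal.ofReal (g t) := fun t ht => by
    simp [hH, ENNReal.toReal_ofReal ht]
  have Hcont : ContinuousOn H {x : ENNReal | x ≠ ⊤} := by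
    have : ContinuousOn (fun x : ENNReal => ENNReal.ofReal (g x.toReal)) {x : ENNReal | x ≠ ⊤} :=
      (ENNReal.continuous_ofReal.comp gcont).comp_continuousOn ENNReal.continuousOn_toReal
    refine this.congr fun x hx => ?_
    simp only [hH]
    rw [if_neg hx]
  refine ⟨H, ⟨⟨?_, ?_, ?_⟩, Hcont⟩, ?_, ?_⟩
  · intro x y hxy
    simp only [hH]
    by_cases hy : y = ⊤
    · simp [hy]
    · have hx : x ≠ ⊤ := ne_top_of_le_ne_top hy hxy
      rw [if_neg hx, if_neg hy]
      exact ENNReal.ofReal_le_ofReal (gmono (ENNReal.toReal_mono hy hxy))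
  · intro x
    simp only [hH]
    by_cases hx : x = ⊤
    · simp [hx]
    · rw [if_neg hx, ENNReal.ofReal_eq_zero]
      constructor
      · intro h
        by_contra h0
        exact absurd (gpos _ (ENNReal.toReal_pos h0 hx)) (not_lt.2 h)
      · rintro rfl
        simp [gzero]
  · intro x
    by_cases hx : x = ⊤
    · subst hx
      simp
    · exact ((Hcont x hx).continuousAt (ENNReal.isOpen_ne_top.mem_nhds hx)).tendsto.mono_left
        nhdsWithin_le_nhds
  · intro n
    rw [Hof _ (he n).le]
    refine ENNReal.ofReal_le_ofReal ?_
    simp only [hg]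
    rw [← (hsum (e n)).sum_add_tsum_nat_add n]
    rw [Finset.sum_eq_zero fun i hi => hle0 i _ (hanti (by simpa using hi)), zero_add]
    calc ∑' j, ramp e N (j + n) (e n) ≤ ∑' j : ℕ, (1 / N n) * ((1 : ℝ) / 2) ^ j :=
          ((summable_nat_add_iff n).2 (hsum (e n))).tsum_le_tsum
            (fun j => (hr1 _ _).trans (hgeo n j)) (hsumgeo n)
      _ = 2 / N n := by
          rw [tsum_mul_left, tsum_geometric_two]
          ring
  · intro n
    rw [Hof _ (by have := he (n + 1); positivity), ← hge1 n]
    exact ENNReal.ofReal_le_ofReal ((hsum _).le_tsum n fun j _ => hr0 j _)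
/-- Distances in `S` are either at most `q` or at least `3 * q`. -/
def Sp {X : Type*} [MetricSpace X] (S : Set X) (q : ℝ) : Prop :=
  ∀ x ∈ S, ∀ y ∈ S, dist x y ≤ q ∨ 3 * q ≤ dist x y

/-- Each `q`-class of `S` splits into exactly `k` many `q'`-classes. -/
def Hom {X : Type*} [MetricSpace X] (S : Set X) (q q' : ℝ) (k : ℕ) : Prop :=
  ∀ x ∈ S, ∃ T : Finset X, (∀ t ∈ T, t ∈ S ∧ dist t x ≤ q) ∧ T.card = k ∧
    (∀ s ∈ T, ∀ t ∈ T, s ≠ t → 3 * q' ≤ dist s t) ∧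
    ∀ y ∈ S, dist y x ≤ q → ∃ t ∈ T, dist y t ≤ q'

theorem Sp.trans' {X : Type*} [MetricSpace X] {S : Set X} {q : ℝ} (hq : 0 < q) (h : Sp S q)
    {x y z : X} (hx : x ∈ S) (hz : z ∈ S) (hxy : dist x y ≤ q) (hyz : dist y z ≤ q) :
    dist x z ≤ q := by
  rcases h x hx z hz with h1 | h1
  · exact h1
  · have := dist_triangle x y z
    linarith

theorem core {X : Type*} [MetricSpace X] [MeasurableSpace X] [BorelSpace X]
    {S : Set X} (hS : IsCompact S) (hne : S.Nonempty) (e : ℕ → ℝ) (k : ℕ → ℕ)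
    (he : ∀ n, 0 < e n) (hsp : ∀ n, Sp S (e n)) (hk : ∀ n, 2 ≤ k n)
    (hhom : ∀ n, Hom S (e n) (e (n + 1)) (k n)) (h0 : ∀ x ∈ S, ∀ y ∈ S, dist x y ≤ e 0) :
    ∃ H : ENNReal → ENNReal, IsContinuousGauge H ∧
      0 < Measure.mkMetric H S ∧ Measure.mkMetric H S < ⊤ := by
  classical
  have he3 : ∀ n, 3 * e (n + 1) ≤ e n := fun n => by
    obtain ⟨x, hx⟩ := hne
    obtain ⟨T, hT, hc, hs, -⟩ := hhom n x hx
    obtain ⟨s, hsT, t, htT, hst⟩ := Finset.one_lt_card.1 (by rw [hc]; exact hk n)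
    refine (hs s hsT t htT hst).trans ?_
    refine (hsp n).trans' (he n) (hT s hsT).1 (hT t htT).1 (hT s hsT).2 ?_
    rw [dist_comm]
    exact (hT t htT).2
  have hanti : Antitone e := antitone_nat_of_succ_le fun n => by
    have := he3 n
    have := he (n + 1)
    linarith
  have hlim : Tendsto e atTop (nhds 0) := by
    have h1 : ∀ n, e n ≤ e 0 * (1 / 2) ^ n := fun n => by
      induction n with
      | zero => simp
      | succ n ih =>
        have := he3 n
        have := he (n + 1)
        rw [pow_succ]
        linarith
    refine squeeze_zero (fun n => (he n).le) h1 ?_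
    have := (tendsto_pow_atTop_nhds_zero_of_lt_one (r := (1 / 2 : ℝ))
      (by norm_num) (by norm_num)).const_mul (e 0)
    simpa using this
  choose! τ hτ1 hτ2 hτ3 hτ4 using hhom
  obtain ⟨x0, hx0⟩ := hne
  obtain ⟨T, T0, Ts⟩ : ∃ T : ℕ → Finset X, T 0 = {x0} ∧ ∀ n, T (n + 1) = (T n).biUnion (τ n) :=
    ⟨fun n => Nat.rec {x0} (fun n A => A.biUnion (τ n)) n, rfl, fun n => rfl⟩
  let N : ℕ → ℕ := fun n => ∏ i ∈ Finset.range n, k i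
  have N0 : N 0 = 1 := by simp [N]
  have Ns : ∀ n, N (n + 1) = N n * k n := fun n => by simp [N, Finset.prod_range_succ]
  have Npos : ∀ n, 0 < N n := fun n => Finset.prod_pos fun i _ => by have := hk i; omega
  have TS : ∀ n, ∀ t ∈ T n, t ∈ S := fun n => by
    induction n with
    | zero => intro t ht; rw [T0, Finset.mem_singleton] at ht; rwa [ht]
    | succ n ih =>
      intro t ht
      rw [Ts, Finset.mem_biUnion] at ht
      obtain ⟨s, hs, hts⟩ := ht
      exact (hτ1 n s (ih s hs) t hts).1
  have Tcov : ∀ n, ∀ x ∈ S, ∃ t ∈ T n, dist x t ≤ e n := fun n => by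
    induction n with
    | zero => exact fun x hx => ⟨x0, by simp [T0], h0 x hx x0 hx0⟩
    | succ n ih =>
      intro x hx
      obtain ⟨t, ht, hxt⟩ := ih x hx
      obtain ⟨s, hs, hxs⟩ := hτ4 n t (TS n t ht) x hx hxt
      exact ⟨s, by rw [Ts, Finset.mem_biUnion]; exact ⟨t, ht, hs⟩, hxs⟩
  have Tsep : ∀ n, ∀ s ∈ T n, ∀ t ∈ T n, s ≠ t → ¬ dist s t ≤ e n := fun n => by
    induction n with
    | zero =>
      intro s hs t ht hst
      rw [T0, Finset.mem_singleton] at hs ht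
      exact absurd (hs.trans ht.symm) hst
    | succ n ih =>
      intro s hs t ht hst hd
      have hsS := TS (n + 1) s hs
      have htS := TS (n + 1) t ht
      rw [Ts, Finset.mem_biUnion] at hs ht
      obtain ⟨a, ha, hsa⟩ := hs
      obtain ⟨b, hb, htb⟩ := ht
      have haS := TS _ a ha
      have hbS := TS _ b hb
      by_cases hab : a = b
      · subst hab
        have := hτ3 n a haS s hsa t htb hst
        have := he (n + 1)
        linarith
      · refine ih a ha b hb hab ?_
        have h1 : dist s b ≤ e n :=
          (hsp n).trans' (he n) hsS hbS (hd.trans (hanti (Nat.le_succ n))) (hτ1 n b hbS t htb).2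
        refine (hsp n).trans' (he n) haS hbS ?_ h1
        rw [dist_comm]
        exact (hτ1 n a haS s hsa).2
  have Tcard : ∀ n, (T n).card = N n := fun n => by
    induction n with
    | zero => simp [T0, N0]
    | succ n ih =>
      rw [Ts, Finset.card_biUnion, Finset.sum_congr rfl fun t ht => hτ2 n t (TS n t ht), Ns,
        Finset.sum_const, ih, smul_eq_mul]
      intro a ha b hb hab
      rw [Function.onFun, Finset.disjoint_left]
      intro s hsa hsb
      have haS := TS _ a ha
      have hbS := TS _ b hb
      refine Tsep n a ha b hb hab ?_
      refine (hsp n).trans' (he n) haS hbS ?_ (hτ1 n b hbS s hsb).2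
      rw [dist_comm]
      exact (hτ1 n a haS s hsa).2
  have Tcount : ∀ n j, ∀ x ∈ S, ((T (n + j)).filter fun t => dist x t ≤ e n).card * N n ≤ N (n + j) := by
    intro n j x hx
    induction j with
    | zero =>
      have : ((T (n + 0)).filter fun t => dist x t ≤ e n).card ≤ 1 := by
        rw [Finset.card_le_one]
        intro a ha b hb
        rw [Finset.mem_filter] at ha hb
        by_contra hab
        refine Tsep n a ha.1 b hb.1 hab ?_
        refine (hsp n).trans' (he n) (TS _ a ha.1) (TS _ b hb.1) ?_ hb.2
        rw [dist_comm]
        exact ha.2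
      calc _ ≤ 1 * N n := by gcongr
        _ = N (n + 0) := by simp
    | succ j ih =>
      have hsub : ((T (n + (j + 1))).filter fun t => dist x t ≤ e n) ⊆
          ((T (n + j)).filter fun t => dist x t ≤ e n).biUnion (τ (n + j)) := by
        intro s hs
        rw [Finset.mem_filter, ← add_assoc, Ts, Finset.mem_biUnion] at hs
        obtain ⟨⟨t, ht, hst⟩, hd⟩ := hs
        rw [Finset.mem_biUnion]
        refine ⟨t, ?_, hst⟩
        rw [Finset.mem_filter]
        refine ⟨ht, (hsp n).trans' (he n) hx (TS _ t ht) hd ?_⟩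
        exact (hτ1 _ t (TS _ t ht) s hst).2.trans (hanti (Nat.le_add_right n j))
      have h1 := Finset.card_le_card hsub
      have h2 : (((T (n + j)).filter fun t => dist x t ≤ e n).biUnion (τ (n + j))).card ≤
          ((T (n + j)).filter fun t => dist x t ≤ e n).card * k (n + j) := by
        refine Finset.card_biUnion_le_card_mul _ _ _ fun t ht => ?_
        rw [hτ2 _ t (TS _ t (Finset.mem_filter.1 ht).1)]
      calc _ ≤ (((T (n + j)).filter fun t => dist x t ≤ e n).card * k (n + j)) * N n := by
            gcongr
            exact h1.trans h2
        _ = (((T (n + j)).filter fun t => dist x t ≤ e n).card * N n) * k (n + j) := by ring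
        _ ≤ N (n + j) * k (n + j) := by gcongr
        _ = N (n + (j + 1)) := by rw [← add_assoc, Ns]
  have N2 : ∀ n, 2 * (N n : ℝ) ≤ N (n + 1) := fun n => by
    rw [Ns]
    push_cast
    have : (2 : ℝ) ≤ k n := by exact_mod_cast hk n
    have : (0 : ℝ) < N n := by exact_mod_cast Npos n
    nlinarith
  obtain ⟨H, Hg, Hup, Hlow⟩ := exists_gauge e (fun n => (N n : ℝ)) he he3 hlim
    (fun n => by exact_mod_cast Npos n) N2
  refine ⟨H, Hg, ?_, ?_⟩
  · -- lower bound
    have hinv : Tendsto (fun n => ENNReal.ofReal (1 / (N n : ℝ))) atTop (nhds 0) := by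
      have h1 : Tendsto (fun n => 1 / (N n : ℝ)) atTop (nhds 0) := by
        refine squeeze_zero (fun n => by positivity) (fun n => ?_)
          (tendsto_pow_atTop_nhds_zero_of_lt_one (r := (1 / 2 : ℝ)) (by norm_num) (by norm_num))
        have := pow_le_N N2 0 n
        simp only [N0, Nat.cast_one, mul_one, add_zero] at this
        rw [div_pow, one_pow]
        exact one_div_le_one_div_of_le (by positivity) this
      simpa using ENNReal.tendsto_ofReal h1
    have key : ∀ t : ℕ → Set X, S ⊆ iUnion t → (∀ n, Metric.ediam (t n) ≤ ENNReal.ofReal (e 0)) →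
        1 / 2 ≤ ∑' n, ⨆ _ : (t n).Nonempty, H (Metric.ediam (t n)) := by
      intro A hA hAd
      obtain ⟨η, hη, hηs⟩ := ENNReal.exists_pos_sum_of_countable' (ε := 1 / 2) (by simp) ℕ
      have hn : ∀ i, ∃ n, Metric.ediam (A i) < ENNReal.ofReal (3 * e n) ∧
          ENNReal.ofReal (1 / (N n : ℝ)) ≤ H (Metric.ediam (A i)) + η i := by
        intro i
        by_cases hd : Metric.ediam (A i) = 0
        · obtain ⟨n, hn⟩ := (hinv.eventually (gt_mem_nhds (hη i))).exists
          refine ⟨n, ?_, hn.le.trans le_add_self⟩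
          rw [hd]
          have := he n
          simp [this]
        · have hex : ∃ n, ENNReal.ofReal (3 * e (n + 1)) ≤ Metric.ediam (A i) := by
            have : Tendsto (fun n => ENNReal.ofReal (3 * e (n + 1))) atTop (nhds 0) := by
              have h1 := ((tendsto_add_atTop_iff_nat 1).2 hlim).const_mul 3
              simpa using ENNReal.tendsto_ofReal h1
            obtain ⟨n, hn⟩ := (this.eventually (gt_mem_nhds (pos_iff_ne_zero.2 hd))).exists
            exact ⟨n, hn.le⟩
          refine ⟨Nat.find hex, ?_, ?_⟩
          · rcases hm : Nat.find hex with _ | m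
            · refine (hAd i).trans_lt ?_
              have := he 0
              rw [ENNReal.ofReal_lt_ofReal_iff] <;> linarith
            · have := Nat.find_min hex (m := m) (by omega)
              exact not_le.1 this
          · exact (Hlow _).trans ((Hg.1.1 (Nat.find_spec hex)).trans le_self_add)
      choose n hn1 hn2 using hn
      let x : ℕ → X := fun i => if h : (A i ∩ S).Nonempty then h.some else x0
      let U : ℕ → Set X := fun i => if (A i ∩ S).Nonempty then Metric.ball (x i) (3 * e (n i)) else ∅
      have hxS : ∀ i, x i ∈ S := fun i => by
        by_cases h : (A i ∩ S).Nonempty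
        · simp only [x, dif_pos h]
          exact h.some_mem.2
        · simp only [x, dif_neg h]
          exact hx0
      have hUo : ∀ i, IsOpen (U i) := fun i => by
        simp only [U]
        split_ifs
        · exact Metric.isOpen_ball
        · exact isOpen_empty
      have hUc : S ⊆ ⋃ i, U i := by
        intro y hy
        obtain ⟨i, hi⟩ := mem_iUnion.1 (hA hy)
        rw [mem_iUnion]
        refine ⟨i, ?_⟩
        have h : (A i ∩ S).Nonempty := ⟨y, hi, hy⟩
        have hxA : x i ∈ A i := by
          simp only [x, dif_pos h]
          exact h.some_mem.1
        simp only [U, if_pos h]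
        rw [Metric.mem_ball]
        have h1 : edist y (x i) < ENNReal.ofReal (3 * e (n i)) :=
          (Metric.edist_le_ediam_of_mem hi hxA).trans_lt (hn1 i)
        rw [edist_dist] at h1
        exact (ENNReal.ofReal_lt_ofReal_iff_of_nonneg dist_nonneg).1 h1
      obtain ⟨J, hJ⟩ := hS.elim_finite_subcover U hUo hUc
      let m := J.sup n
      have hcov : T m ⊆ (J.filter fun i => (A i ∩ S).Nonempty).biUnion
          fun i => (T m).filter fun t => dist (x i) t ≤ e (n i) := by
        intro t ht
        have htS := TS m t ht
        obtain ⟨i, hi, hti⟩ := mem_iUnion₂.1 (hJ htS)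
        by_cases h : (A i ∩ S).Nonempty
        · simp only [U, if_pos h, Metric.mem_ball] at hti
          rw [Finset.mem_biUnion]
          refine ⟨i, by simp [hi, h], ?_⟩
          rw [Finset.mem_filter]
          refine ⟨ht, ?_⟩
          rcases hsp (n i) (x i) (hxS i) t htS with h1 | h1
          · exact h1
          · rw [dist_comm] at hti
            linarith
        · simp [U, if_neg h] at hti
      have hNm : (0 : ℝ) < N m := by exact_mod_cast Npos m
      have hreal : (1 : ℝ) ≤ ∑ i ∈ J.filter (fun i => (A i ∩ S).Nonempty), 1 / (N (n i) : ℝ) := by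
        have h1 := (Finset.card_le_card hcov).trans Finset.card_biUnion_le
        rw [Tcard] at h1
        have h2 : (N m : ℝ) ≤ ∑ i ∈ J.filter (fun i => (A i ∩ S).Nonempty),
            (((T m).filter fun t => dist (x i) t ≤ e (n i)).card : ℝ) := by exact_mod_cast h1
        have h3 : ∀ i ∈ J.filter (fun i => (A i ∩ S).Nonempty),
            (((T m).filter fun t => dist (x i) t ≤ e (n i)).card : ℝ) ≤ N m * (1 / N (n i)) := by
          intro i hi
          have hle : n i ≤ m := Finset.le_sup (f := n) (Finset.mem_filter.1 hi).1
          have h4 := Tcount (n i) (m - n i) (x i) (hxS i)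
          rw [Nat.add_sub_cancel' hle] at h4
          have h5 : (0 : ℝ) < N (n i) := by exact_mod_cast Npos _
          rw [mul_one_div, le_div_iff₀ h5]
          exact_mod_cast h4
        have h6 := h2.trans (Finset.sum_le_sum h3)
        rw [← Finset.mul_sum] at h6
        nlinarith
      have hen : (1 : ENNReal) ≤ (∑' i, ⨆ _ : (A i).Nonempty, H (Metric.ediam (A i))) + 1 / 2 := by
        calc (1 : ENNReal) = ENNReal.ofReal 1 := by simp
          _ ≤ ENNReal.ofReal (∑ i ∈ J.filter (fun i => (A i ∩ S).Nonempty), 1 / (N (n i) : ℝ)) :=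
            ENNReal.ofReal_le_ofReal hreal
          _ = ∑ i ∈ J.filter (fun i => (A i ∩ S).Nonempty), ENNReal.ofReal (1 / (N (n i) : ℝ)) :=
            ENNReal.ofReal_sum_of_nonneg fun i _ => by positivity
          _ ≤ ∑ i ∈ J.filter (fun i => (A i ∩ S).Nonempty),
              ((⨆ _ : (A i).Nonempty, H (Metric.ediam (A i))) + η i) := by
            refine Finset.sum_le_sum fun i hi => (hn2 i).trans ?_
            have : (A i).Nonempty := (Finset.mem_filter.1 hi).2.mono inter_subset_left
            simp [this]
          _ ≤ ∑' i, ((⨆ _ : (A i).Nonempty, H (Metric.ediam (A i))) + η i) :=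
            ENNReal.sum_le_tsum _
          _ = (∑' i, ⨆ _ : (A i).Nonempty, H (Metric.ediam (A i))) + ∑' i, η i :=
            ENNReal.tsum_add
          _ ≤ _ := by gcongr
      have := tsub_le_iff_right.2 hen
      refine le_trans (le_of_eq ?_) this
      simp
    rw [Measure.mkMetric_apply]
    refine lt_of_lt_of_le (b := 1 / 2) (by simp) ?_
    refine le_trans ?_ (le_iSup₂ (ENNReal.ofReal (e 0)) (by simpa using he 0))
    exact le_iInf fun t => le_iInf fun ht => le_iInf fun htd => key t ht htd
  · -- upper bound
    refine lt_of_le_of_lt (b := 2) ?_ (by simp)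
    have h1 := Measure.mkMetric_le_liminf_sum (X := X) (β := ℕ) (ι := fun n => {x // x ∈ T n})
      (hι := fun n => Finset.fintypeCoeSort (T n)) S (l := atTop)
      (fun n => ENNReal.ofReal (e n)) (by simpa using ENNReal.tendsto_ofReal hlim)
      (fun n (t : T n) => S ∩ Metric.closedBall (t : X) (e n)) ?_ ?_ H
    · refine h1.trans ?_
      have h2 : ∀ n, ∑ t : {x // x ∈ T n}, H (Metric.ediam (S ∩ Metric.closedBall (t : X) (e n))) ≤ 2 := by
        intro n
        calc _ ≤ ∑ t : {x // x ∈ T n}, ENNReal.ofReal (2 / N n) := by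
              refine Finset.sum_le_sum fun t _ => le_trans (Hg.1.1 ?_) (Hup n)
              refine Metric.ediam_le fun a ha b hb => ?_
              rw [edist_dist]
              refine ENNReal.ofReal_le_ofReal ((hsp n).trans' (he n) ha.1 hb.1 ha.2 ?_)
              rw [dist_comm]
              exact hb.2
          _ = N n * ENNReal.ofReal (2 / N n) := by
              simp [Tcard]
          _ = ENNReal.ofReal (N n * (2 / N n)) := by
              rw [ENNReal.ofReal_mul (by positivity), ENNReal.ofReal_natCast]
          _ = 2 := by
              have : (N n : ℝ) ≠ 0 := by exact_mod_cast (Npos n).ne'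
              rw [mul_div_cancel₀ _ this]
              simp
      calc _ ≤ liminf (fun _ : ℕ => (2 : ENNReal)) atTop :=
            liminf_le_liminf (Eventually.of_forall h2)
        _ = 2 := by simp
    · refine Eventually.of_forall fun n t => ?_
      refine Metric.ediam_le fun a ha b hb => ?_
      rw [edist_dist]
      refine ENNReal.ofReal_le_ofReal ((hsp n).trans' (he n) ha.1 hb.1 ha.2 ?_)
      rw [dist_comm]
      exact hb.2
    · refine Eventually.of_forall fun n y hy => ?_
      obtain ⟨t, ht, hyt⟩ := Tcov n y hy
      exact mem_iUnion.2 ⟨⟨t, ht⟩, hy, hyt⟩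
theorem stab {X : Type*} [MetricSpace X] {S : Set X} {B : Finset X} {q q' ρ : ℝ} {M : ℕ}
    (hS : Sp S q) (hB : Sp (B : Set X) q) (hρq : ρ < q) (hρq' : 2 * ρ ≤ q')
    (hSB : ∀ x ∈ S, ∃ f ∈ B, dist x f < ρ) (hBS : ∀ f ∈ B, ∃ x ∈ S, dist x f < ρ)
    (hsep : ∀ f ∈ B, ∀ g ∈ B, f ≠ g → 4 * q' ≤ dist f g)
    (hM : ∀ f ∈ B, (B.filter fun g => dist f g ≤ q).card = M) :
    Sp S q' ∧ Hom S q q' M := by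
  classical
  choose! φ hφB hφd using hSB
  choose! σ hσS hσd using hBS
  have tri : ∀ x f y g : X, dist x f < ρ → dist y g < ρ →
      dist x y < dist f g + 2 * ρ ∧ dist f g < dist x y + 2 * ρ := by
    intro x f y g h1 h2
    have h3 := dist_triangle4 x f g y
    have h4 := dist_triangle4 f x y g
    rw [dist_comm g y] at h3
    rw [dist_comm f x] at h4
    constructor <;> linarith
  refine ⟨?_, ?_⟩
  · intro x hx y hy
    have h := tri x (φ x) y (φ y) (hφd x hx) (hφd y hy)
    by_cases hxy : φ x = φ y
    · rw [hxy, dist_self] at h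
      left
      linarith [h.1]
    · have := hsep _ (hφB x hx) _ (hφB y hy) hxy
      right
      linarith [h.2]
  · intro x hx
    have hf := hφB x hx
    have hsep' : ∀ f ∈ B, ∀ g ∈ B, f ≠ g → 3 * q' ≤ dist (σ f) (σ g) := by
      intro f hf g hg hfg
      have h := tri _ _ _ _ (hσd f hf) (hσd g hg)
      have := hsep f hf g hg hfg
      linarith [h.2]
    have hρ : 0 < ρ := dist_nonneg.trans_lt (hφd x hx)
    refine ⟨(B.filter fun g => dist (φ x) g ≤ q).image σ, ?_, ?_, ?_, ?_⟩
    · intro t ht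
      rw [Finset.mem_image] at ht
      obtain ⟨g, hg, rfl⟩ := ht
      rw [Finset.mem_filter] at hg
      refine ⟨hσS g hg.1, ?_⟩
      have h := (tri _ _ _ _ (hφd x hx) (hσd g hg.1)).1
      rcases hS _ (hσS g hg.1) _ hx with h1 | h1
      · exact h1
      · rw [dist_comm] at h1
        linarith [hg.2]
    · rw [Finset.card_image_of_injOn, hM _ hf]
      intro f hf' g hg hfg
      by_contra hne
      simp only [Finset.coe_filter, mem_ofPred_eq] at hf' hg
      have := hsep' f hf'.1 g hg.1 hne
      rw [hfg, dist_self] at this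
      linarith
    · intro s hs t ht hst
      rw [Finset.mem_image] at hs ht
      obtain ⟨f, hf, rfl⟩ := hs
      obtain ⟨g, hg, rfl⟩ := ht
      rw [Finset.mem_filter] at hf hg
      exact hsep' f hf.1 g hg.1 fun h => hst (by rw [h])
    · intro y hy hyx
      have h := (tri _ _ _ _ (hφd x hx) (hφd y hy)).2
      have hg := hφB y hy
      refine ⟨σ (φ y), ?_, ?_⟩
      · rw [Finset.mem_image]
        refine ⟨φ y, ?_, rfl⟩
        rw [Finset.mem_filter]
        refine ⟨hg, ?_⟩
        rcases hB _ hf _ hg with h1 | h1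
        · exact h1
        · rw [dist_comm] at hyx
          linarith
      · have h2 := (tri _ _ _ _ (hφd y hy) (hσd _ hg)).1
        rw [dist_self] at h2
        linarith

theorem fill {X : Type*} [MetricSpace X] {V : Set X} (hV : IsOpen V)
    (hinf : ∀ W : Set X, IsOpen W → W ⊆ V → W.Nonempty → W.Infinite)
    (A : Finset X) (hA : ∀ a ∈ A, a ∈ V) {q η : ℝ} (hq : 0 < q) (hη : 0 < η) (hηq : η ≤ q) :
    ∃ B : Finset X, A ⊆ B ∧ (∀ b ∈ B, b ∈ V ∧ ∃ a ∈ A, dist b a < η) ∧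
      (Sp (B : Set X) q → ∀ b ∈ B, (B.filter fun g => dist b g ≤ q).card = A.card + 2) := by
  classical
  let c : X → Finset X := fun a => A.filter fun g => dist a g ≤ q
  have hself : ∀ a ∈ A, a ∈ c a := fun a ha => by simp [c, ha, hq.le]
  have hex : ∀ a ∈ A, ∃ T : Finset X, c a ⊆ T ∧
      (∀ t ∈ T, t ∈ V ∧ ∃ f ∈ c a, dist t f < η) ∧ T.card = A.card + 2 := by
    intro a ha
    have hWo : IsOpen (V ∩ ⋃ f ∈ c a, Metric.ball f η) :=
      hV.inter (isOpen_biUnion fun f _ => Metric.isOpen_ball)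
    have hsub : (c a : Set X) ⊆ V ∩ ⋃ f ∈ c a, Metric.ball f η := by
      intro f hf
      have hf' : f ∈ c a := hf
      refine ⟨hA f (Finset.mem_filter.1 hf').1, mem_iUnion₂.2 ⟨f, hf', Metric.mem_ball_self hη⟩⟩
    obtain ⟨s, hs1, hs2, hs3⟩ := (hinf _ hWo inter_subset_left ⟨a, hsub (hself a ha)⟩).exists_superset_ncard_eq
      hsub (c a).finite_toSet (k := A.card + 2) (by
        rw [ncard_coe_finset]
        exact (Finset.card_filter_le _ _).trans (by omega))
    have hsf : s.Finite := finite_of_ncard_ne_zero (by omega)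
    refine ⟨hsf.toFinset, ?_, ?_, ?_⟩
    · intro f hf
      rw [Finite.mem_toFinset]
      exact hs1 hf
    · intro t ht
      rw [Finite.mem_toFinset] at ht
      obtain ⟨h1, h2⟩ := hs2 ht
      obtain ⟨f, hf, htf⟩ := mem_iUnion₂.1 h2
      exact ⟨h1, f, hf, htf⟩
    · rw [← hs3, ncard_eq_toFinset_card s hsf]
  have hex' : ∀ C : Finset X, C ∈ A.image c → ∃ T : Finset X, C ⊆ T ∧
      (∀ t ∈ T, t ∈ V ∧ ∃ f ∈ C, dist t f < η) ∧ T.card = A.card + 2 := by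
    intro C hC
    obtain ⟨a, ha, rfl⟩ := Finset.mem_image.1 hC
    exact hex a ha
  choose! T hT1 hT2 hT3 using hex'
  have hcm : ∀ a ∈ A, c a ∈ A.image c := fun a ha => Finset.mem_image_of_mem c ha
  have hmem : ∀ b, b ∈ (A.image c).biUnion T ↔ ∃ a ∈ A, b ∈ T (c a) := by
    intro b
    simp [Finset.mem_biUnion]
  have hAB : A ⊆ (A.image c).biUnion T := fun a ha =>
    (hmem a).2 ⟨a, ha, hT1 _ (hcm a ha) (hself a ha)⟩
  refine ⟨(A.image c).biUnion T, hAB, ?_, ?_⟩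
  · intro b hb
    obtain ⟨a, ha, hba⟩ := (hmem b).1 hb
    obtain ⟨h1, f, hf, h2⟩ := hT2 _ (hcm a ha) b hba
    exact ⟨h1, f, (Finset.mem_filter.1 hf).1, h2⟩
  · intro hsp b hb
    have near : ∀ a ∈ A, ∀ t ∈ T (c a), dist a t ≤ q := by
      intro a ha t ht
      obtain ⟨h1, f, hf, h2⟩ := hT2 _ (hcm a ha) t ht
      refine hsp.trans' hq (hAB ha) ((hmem t).2 ⟨a, ha, ht⟩) (Finset.mem_filter.1 hf).2 ?_
      rw [dist_comm]
      exact h2.le.trans hηq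
    obtain ⟨a, ha, hba⟩ := (hmem b).1 hb
    have : ((A.image c).biUnion T).filter (fun g => dist b g ≤ q) = T (c a) := by
      ext g
      rw [Finset.mem_filter]
      constructor
      · rintro ⟨hg, hbg⟩
        obtain ⟨a', ha', hga⟩ := (hmem g).1 hg
        have h1 : dist a g ≤ q := hsp.trans' hq (hAB ha) hg (near a ha b hba) hbg
        have h2 : dist a a' ≤ q := hsp.trans' hq (hAB ha) (hAB ha') h1
          (by rw [dist_comm]; exact near a' ha' g hga)
        have h3 : c a = c a' := by
          ext f
          simp only [c, Finset.mem_filter]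
          constructor
          · rintro ⟨hf, h⟩
            exact ⟨hf, hsp.trans' hq (hAB ha') (hAB hf) (by rw [dist_comm]; exact h2) h⟩
          · rintro ⟨hf, h⟩
            exact ⟨hf, hsp.trans' hq (hAB ha) (hAB hf) h2 h⟩
        rw [h3]
        exact hga
      · intro hg
        have hgB := (hmem g).2 ⟨a, ha, hg⟩
        exact ⟨hgB, hsp.trans' hq hb hgB (by rw [dist_comm]; exact near a ha b hba)
          (near a ha g hg)⟩
    rw [this, hT3 _ (hcm a ha)]

/-- The set of isolated points. -/
def isol (X : Type*) [MetricSpace X] : Set X := {x | IsOpen ({x} : Set X)}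

/-- The part of the space away from the isolated points. -/
def perf (X : Type*) [MetricSpace X] : Set X := (closure (isol X))ᶜ

theorem isOpen_isol (X : Type*) [MetricSpace X] : IsOpen (isol X) := by
  rw [isOpen_iff_forall_mem_open]
  intro x hx
  refine ⟨{x}, ?_, hx, rfl⟩
  rintro y rfl
  exact hx

theorem isOpen_perf (X : Type*) [MetricSpace X] : IsOpen (perf X) :=
  isClosed_closure.isOpen_compl

theorem not_isol_perf {X : Type*} [MetricSpace X] {x : X} (h1 : x ∈ isol X) (h2 : x ∈ perf X) :
    False := h2 (subset_closure h1)

theorem dense_union (X : Type*) [MetricSpace X] : Dense (perf X ∪ isol X) := by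
  intro x
  by_cases hx : x ∈ closure (isol X)
  · exact closure_mono subset_union_right hx
  · exact subset_closure (Or.inl hx)

theorem perf_infinite {X : Type*} [MetricSpace X] (W : Set X) (hW : IsOpen W) (hWV : W ⊆ perf X)
    (hne : W.Nonempty) : W.Infinite := by
  intro hfin
  obtain ⟨x, hx⟩ := hne
  refine not_isol_perf (x := x) ?_ (hWV hx)
  have h1 : IsOpen (W \ (W \ {x})) := hW.sdiff (hfin.subset sdiff_subset).isClosed
  have h2 : W \ (W \ {x}) = {x} := by
    ext y
    simp only [Set.mem_sdiff, mem_singleton_iff]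
    constructor
    · rintro ⟨h3, h4⟩
      by_contra h5
      exact h4 ⟨h3, h5⟩
    · rintro rfl
      exact ⟨hx, fun h => h.2 rfl⟩
  rw [h2] at h1
  exact h1

/-- The compact set given by a nonempty finset. -/
def ofFin {X : Type*} [MetricSpace X] (F : Finset X) (h : F.Nonempty) : NonemptyCompacts X :=
  ⟨⟨(F : Set X), F.finite_toSet.isCompact⟩, h⟩

theorem coe_ofFin {X : Type*} [MetricSpace X] (F : Finset X) (h : F.Nonempty) :
    (ofFin F h : Set X) = F := rfl

theorem nc_near {X : Type*} [MetricSpace X] {K L : NonemptyCompacts X} {r : ℝ}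
    (h : dist K L < r) {x : X} (hx : x ∈ (K : Set X)) : ∃ y ∈ (L : Set X), dist x y < r := by
  rw [Metric.NonemptyCompacts.dist_eq] at h
  exact Metric.exists_dist_lt_of_hausdorffDist_lt hx h
    (Metric.hausdorffEDist_ne_top_of_nonempty_of_bounded K.nonempty L.nonempty
      K.isCompact.isBounded L.isCompact.isBounded)

theorem nc_dist_le {X : Type*} [MetricSpace X] {K L : NonemptyCompacts X} {r : ℝ} (hr : 0 ≤ r)
    (h1 : ∀ x ∈ (K : Set X), ∃ y ∈ (L : Set X), dist x y ≤ r)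
    (h2 : ∀ x ∈ (L : Set X), ∃ y ∈ (K : Set X), dist x y ≤ r) : dist K L ≤ r := by
  rw [Metric.NonemptyCompacts.dist_eq]
  exact Metric.hausdorffDist_le_of_mem_dist hr h1 h2

theorem finite_approx {X : Type*} [MetricSpace X] (K : NonemptyCompacts X) {r : ℝ} (hr : 0 < r) :
    ∃ (F : Finset X) (h : F.Nonempty), (∀ x ∈ F, x ∈ perf X ∪ isol X) ∧ dist (ofFin F h) K ≤ r := by
  classical
  obtain ⟨t, htK, htf, htc⟩ := finite_cover_balls_of_compact K.isCompact (half_pos hr)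
  have hg : ∀ x : X, ∃ y ∈ perf X ∪ isol X, dist x y < r / 2 := fun x =>
    (dense_union X).exists_dist_lt x (half_pos hr)
  choose g hgm hgd using hg
  have hmem : ∀ x, x ∈ htf.toFinset.image g ↔ ∃ y ∈ t, g y = x := by simp
  obtain ⟨x, hx⟩ := K.nonempty
  obtain ⟨y, hy, hxy⟩ := mem_iUnion₂.1 (htc hx)
  refine ⟨htf.toFinset.image g, ⟨g y, (hmem _).2 ⟨y, hy, rfl⟩⟩, ?_, nc_dist_le hr.le ?_ ?_⟩
  · intro x hx
    obtain ⟨y, hy, rfl⟩ := (hmem _).1 hx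
    exact hgm y
  · intro x hx
    obtain ⟨y, hy, rfl⟩ := (hmem _).1 hx
    refine ⟨y, htK hy, ?_⟩
    rw [dist_comm]
    linarith [hgd y]
  · intro x hx
    obtain ⟨y, hy, hxy⟩ := mem_iUnion₂.1 (htc hx)
    refine ⟨g y, (hmem _).2 ⟨y, hy, rfl⟩, ?_⟩
    have := dist_triangle x y (g y)
    rw [Metric.mem_ball] at hxy
    linarith [hgd y]

/-- The refinement property at scale `q`. -/
def Good (X : Type*) [MetricSpace X] (q : ℝ) : Set (NonemptyCompacts X) :=
  {K | Sp ((K : Set X) ∩ perf X) q → ∃ q' : ℚ, (0 : ℝ) < q' ∧ Sp ((K : Set X) ∩ perf X) q' ∧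
    ∃ k : ℕ, 2 ≤ k ∧ Hom ((K : Set X) ∩ perf X) q q' k}

theorem good_residual (X : Type*) [MetricSpace X] {q : ℝ} (hq : 0 < q) :
    Good X q ∈ residual (NonemptyCompacts X) := by
  classical
  refine mem_of_superset (residual_of_dense_open (isOpen_interior (s := Good X q)) ?_)
    interior_subset
  rw [Metric.dense_iff]
  intro K0 r hr
  by_cases hA : ∀ K ∈ Metric.ball K0 r, Sp ((K : Set X) ∩ perf X) q
  · obtain ⟨F0, hF0, hF0m, hF0d⟩ := finite_approx K0 (show 0 < r / 4 by positivity)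
    have hη : 0 < min q (r / 4) := lt_min hq (by positivity)
    obtain ⟨B, hAB, hB1, hB2⟩ := fill (isOpen_perf X) perf_infinite
      (F0.filter (· ∈ perf X)) (fun a ha => (Finset.mem_filter.1 ha).2) hq hη (min_le_left _ _)
    have hF1 : (F0 ∪ B).Nonempty := hF0.mono Finset.subset_union_left
    have hF1V : ((F0 ∪ B : Finset X) : Set X) ∩ perf X = B := by
      ext x
      simp only [Finset.coe_union, mem_inter_iff, mem_union, Finset.mem_coe]
      constructor
      · rintro ⟨h1 | h1, h2⟩
        · exact hAB (Finset.mem_filter.2 ⟨h1, h2⟩)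
        · exact h1
      · intro h
        exact ⟨Or.inr h, (hB1 x h).1⟩
    have hF1d : dist (ofFin (F0 ∪ B) hF1) (ofFin F0 hF0) ≤ r / 4 := by
      refine nc_dist_le (by positivity) ?_ ?_
      · intro x hx
        rw [coe_ofFin, Finset.mem_coe, Finset.mem_union] at hx
        rcases hx with hx | hx
        · exact ⟨x, hx, by rw [dist_self]; positivity⟩
        · obtain ⟨-, a, ha, hd⟩ := hB1 x hx
          exact ⟨a, (Finset.mem_filter.1 ha).1, hd.le.trans (min_le_right _ _)⟩
      · intro x hx
        exact ⟨x, Finset.mem_union_left _ hx, by rw [dist_self]; positivity⟩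
    have hF1K : dist (ofFin (F0 ∪ B) hF1) K0 ≤ r / 2 := by
      have := dist_triangle (ofFin (F0 ∪ B) hF1) (ofFin F0 hF0) K0
      linarith
    have hspB : Sp (B : Set X) q := by
      rw [← hF1V]
      exact hA (ofFin (F0 ∪ B) hF1) (by rw [Metric.mem_ball]; linarith)
    -- separation
    obtain ⟨s, hs, hsep⟩ : ∃ s : ℝ, 0 < s ∧ ∀ f ∈ B, ∀ g ∈ B, f ≠ g → s ≤ dist f g := by
      have : ∃ s > 0, ∀ f ∈ (B : Set X), ∀ g ∈ (B : Set X), f ≠ g → s ≤ dist f g := by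
        by_cases hoff : B.offDiag.Nonempty
        · obtain ⟨p, hp, hmin⟩ := B.offDiag.exists_min_image (fun p => dist p.1 p.2) hoff
          rw [Finset.mem_offDiag] at hp
          exact ⟨dist p.1 p.2, dist_pos.2 hp.2.2, fun f hf g hg hfg =>
            hmin (f, g) (Finset.mem_offDiag.2 ⟨hf, hg, hfg⟩)⟩
        · refine ⟨1, one_pos, fun f hf g hg hfg => ?_⟩
          exact absurd ⟨(f, g), Finset.mem_offDiag.2 ⟨hf, hg, hfg⟩⟩ hoff
      exact this
    obtain ⟨q', hq'0, hq's⟩ := exists_rat_btwn (show (0 : ℝ) < s / 4 by positivity)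
    have hthick : ∃ δ > 0, ∀ f ∈ F0 ∪ B, ∀ y, dist y f < δ →
        (f ∈ perf X → y ∈ perf X) ∧ (f ∈ isol X → y ∈ isol X) := by
      obtain ⟨δ1, hδ1, h1⟩ := ((B.finite_toSet.isCompact).exists_thickening_subset_open
        (isOpen_perf X) (fun b hb => (hB1 b hb).1))
      obtain ⟨δ2, hδ2, h2⟩ := (((F0 ∪ B).filter (· ∈ isol X)).finite_toSet.isCompact).exists_thickening_subset_open
        (isOpen_isol X) (fun b hb => (Finset.mem_filter.1 hb).2)
      refine ⟨min δ1 δ2, lt_min hδ1 hδ2, fun f hf y hy => ⟨fun hfV => ?_, fun hfI => ?_⟩⟩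
      · refine h1 (Metric.mem_thickening_iff.2 ⟨f, ?_, hy.trans_le (min_le_left _ _)⟩)
        rw [← hF1V]
        exact ⟨hf, hfV⟩
      · refine h2 (Metric.mem_thickening_iff.2 ⟨f, ?_, hy.trans_le (min_le_right _ _)⟩)
        exact Finset.mem_filter.2 ⟨hf, hfI⟩
    obtain ⟨δ, hδ, hδ'⟩ := hthick
    let ρ : ℝ := min (min δ (q / 2)) ((q' : ℝ) / 2)
    have hρ : 0 < ρ := lt_min (lt_min hδ (by positivity)) (by positivity)
    have hρδ : ρ ≤ δ := (min_le_left _ _).trans (min_le_left _ _)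
    have hρq : ρ ≤ q / 2 := (min_le_left _ _).trans (min_le_right _ _)
    have hρq' : ρ ≤ q' / 2 := min_le_right _ _
    refine ⟨ofFin (F0 ∪ B) hF1, by rw [Metric.mem_ball]; linarith, ?_⟩
    rw [mem_interior]
    refine ⟨Metric.ball _ ρ, ?_, Metric.isOpen_ball, Metric.mem_ball_self hρ⟩
    intro K hK hKq
    rw [Metric.mem_ball] at hK
    have hst := stab (S := (K : Set X) ∩ perf X) (B := B) (q := q) (q' := q') (ρ := ρ)
      hKq hspB (by linarith) (by linarith) ?_ ?_ ?_ (hB2 hspB)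
    · exact ⟨q', hq'0, hst.1, _, by omega, hst.2⟩
    · rintro x ⟨hxK, hxV⟩
      obtain ⟨f, hf, hxf⟩ := nc_near hK hxK
      refine ⟨f, ?_, hxf⟩
      rw [coe_ofFin, Finset.mem_coe] at hf
      have h1 := hδ' f hf x (hxf.trans_le hρδ)
      rcases Finset.mem_union.1 hf with h2 | h2
      · rcases hF0m f h2 with h3 | h3
        · exact hAB (Finset.mem_filter.2 ⟨h2, h3⟩)
        · exact (not_isol_perf (h1.2 h3) hxV).elim
      · exact h2
    · intro f hf
      have hfm : f ∈ F0 ∪ B := Finset.mem_union_right _ hf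
      rw [dist_comm] at hK
      obtain ⟨x, hx, hfx⟩ := nc_near hK (show f ∈ (ofFin (F0 ∪ B) hF1 : Set X) from hfm)
      rw [dist_comm] at hfx
      exact ⟨x, ⟨hx, (hδ' f hfm x (hfx.trans_le hρδ)).1 (hB1 f hf).1⟩, hfx⟩
    · intro f hf g hg hfg
      have := hsep f hf g hg hfg
      linarith
  · push Not at hA
    obtain ⟨K, hK, hKs⟩ := hA
    refine ⟨K, hK, ?_⟩
    unfold Sp at hKs
    push Not at hKs
    obtain ⟨x, hx, y, hy, h1, h2⟩ := hKs
    rw [mem_interior]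
    have hopen : IsOpen {p : X × X | p.1 ∈ perf X ∧ p.2 ∈ perf X ∧ q < dist p.1 p.2 ∧
        dist p.1 p.2 < 3 * q} :=
      ((isOpen_perf X).preimage continuous_fst).inter
        (((isOpen_perf X).preimage continuous_snd).inter
          ((isOpen_lt continuous_const continuous_dist).inter
            (isOpen_lt continuous_dist continuous_const)))
    obtain ⟨U, W, hU, hW, hxU, hyW, hUW⟩ := isOpen_prod_iff.1 hopen x y ⟨hx.2, hy.2, h1, h2⟩
    refine ⟨{L | ((L : Set X) ∩ U).Nonempty} ∩ {L | ((L : Set X) ∩ W).Nonempty}, ?_,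
      (NonemptyCompacts.isOpen_inter_nonempty_of_isOpen hU).inter
        (NonemptyCompacts.isOpen_inter_nonempty_of_isOpen hW), ⟨x, hx.1, hxU⟩, ⟨y, hy.1, hyW⟩⟩
    rintro L ⟨⟨a, haL, haU⟩, ⟨b, hbL, hbW⟩⟩ hL
    obtain ⟨h3, h4, h5, h6⟩ := hUW (mk_mem_prod haU hbW)
    rcases hL a ⟨haL, h3⟩ b ⟨hbL, h4⟩ with h | h
    · exact absurd h (not_le.2 h5)
    · exact absurd h (not_le.2 h6)

theorem subset_residual (X : Type*) [MetricSpace X] :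
    {K : NonemptyCompacts X | (K : Set X) ⊆ perf X ∪ isol X} ∈ residual (NonemptyCompacts X) := by
  refine residual_of_dense_open
    (NonemptyCompacts.isOpen_subsets_of_isOpen ((isOpen_perf X).union (isOpen_isol X))) ?_
  rw [Metric.dense_iff]
  intro K r hr
  obtain ⟨F, hF, hFm, hFd⟩ := finite_approx K (half_pos hr)
  exact ⟨ofFin F hF, by rw [Metric.mem_ball]; linarith, fun x hx => hFm x hx⟩

theorem mkMetric_finite {X : Type*} [MetricSpace X] [MeasurableSpace X] [BorelSpace X]
    {H : ENNReal → ENNReal} (hH : H 0 = 0) {A : Set X} (hA : A.Finite) :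
    Measure.mkMetric H A = 0 := by
  have := hA.to_subtype
  have h1 := Measure.mkMetric_le_liminf_tsum (X := X) (ι := fun _ : ℕ => A) A (l := atTop)
    (fun _ => 0) tendsto_const_nhds (fun _ (a : A) => {(a : X)}) (by simp) (by simp) H
  simpa [hH] using h1

theorem generic_compact_finite_or_gauge_visible
    {X : Type*} [MetricSpace X] [CompleteSpace X] [SeparableSpace X]
    [MeasurableSpace X] [BorelSpace X] :
    {K : NonemptyCompacts X | (K : Set X).Finite ∨
        ∃ h : ENNReal → ENNReal, IsContinuousGauge h ∧
          0 < Measure.mkMetric h (K : Set X) ∧ Measure.mkMetric h (K : Set X) < ⊤} ∈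
      residual (NonemptyCompacts X) := by
  have hall : ∀ᶠ K in residual (NonemptyCompacts X), ∀ q : {q : ℚ // (0 : ℝ) < q}, K ∈ Good X q.1 :=
    eventually_countable_forall.2 fun q => good_residual X q.2
  filter_upwards [hall, subset_residual X] with K hK hKs
  have hfin : ((K : Set X) \ perf X).Finite := by
    have hc : IsCompact ((K : Set X) \ perf X) := K.isCompact.diff (isOpen_perf X)
    refine hc.finite ?_
    rw [isDiscrete_iff_forall_mem_exists_isOpen]
    intro x hx
    have hxI : x ∈ isol X := (hKs hx.1).resolve_left hx.2
    refine ⟨{x}, hxI, ?_⟩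
    ext y
    simp only [mem_inter_iff, mem_singleton_iff]
    constructor
    · exact fun h => h.1
    · rintro rfl
      exact ⟨rfl, hx⟩
  have hunion : ((K : Set X) ∩ perf X) ∪ ((K : Set X) \ perf X) = K := inter_union_sdiff _ _
  by_cases hne : ((K : Set X) ∩ perf X).Nonempty
  · right
    have hScomp : IsCompact ((K : Set X) ∩ perf X) := by
      have : (K : Set X) ∩ perf X = (K : Set X) \ isol X := by
        ext x
        constructor
        · exact fun h => ⟨h.1, fun h' => not_isol_perf h' h.2⟩
        · exact fun h => ⟨h.1, (hKs h.1).resolve_right h.2⟩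
      rw [this]
      exact K.isCompact.diff (isOpen_isol X)
    set S := (K : Set X) ∩ perf X with hSdef
    let P := {q : ℚ // (0 : ℝ) < q ∧ Sp S q}
    have hstep : ∀ p : P, ∃ p' : P, ∃ k : ℕ, 2 ≤ k ∧ Hom S p.1 p'.1 k := by
      rintro ⟨q, hq, hs⟩
      obtain ⟨q', h1, h2, k, h3, h4⟩ := hK ⟨q, hq⟩ hs
      exact ⟨⟨q', h1, h2⟩, k, h3, h4⟩
    choose next k hk hhom using hstep
    obtain ⟨q0, hq0⟩ := exists_rat_gt (Metric.diam S)
    have hd0 : ∀ x ∈ S, ∀ y ∈ S, dist x y ≤ q0 := fun x hx y hy =>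
      (Metric.dist_le_diam_of_mem hScomp.isBounded hx hy).trans hq0.le
    let p0 : P := ⟨q0, Metric.diam_nonneg.trans_lt hq0, fun x hx y hy => Or.inl (hd0 x hx y hy)⟩
    let p : ℕ → P := fun n => Nat.rec p0 (fun _ a => next a) n
    obtain ⟨H, hH, h1, h2⟩ := core hScomp hne (fun n => ((p n).1 : ℝ)) (fun n => k (p n))
      (fun n => (p n).2.1) (fun n => (p n).2.2) (fun n => hk (p n)) (fun n => hhom (p n)) hd0
    refine ⟨H, hH, h1.trans_le (measure_mono inter_subset_left), ?_⟩
    rw [← hunion]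
    refine (measure_union_le _ _).trans_lt ?_
    rw [mkMetric_finite ((hH.1.2.1 0).2 rfl) hfin, add_zero]
    exact h2
  · left
    rw [← hunion, not_nonempty_iff_eq_empty.1 hne, empty_union]
    exact hfin
end

section
/- Let X be a perfect Polish space (a complete separable metric space with no isolated points). Then for a generic non-empty compact set K ⊆ X there exists a continuous gauge function h such that 0 < H^h(K) < ∞. -/
open MeasureTheory Filter Set TopologicalSpace

/-- `F` is a `5 ε`-separated finite set. -/
def GVGood {X : Type*} [MetricSpace X] (F : Finset X) (ε : ℝ) : Prop :=
  0 < ε ∧ ∀ x ∈ F, ∀ y ∈ F, x ≠ y → 5 * ε ≤ dist x y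

/-- Compact sets that are `ε`-close to `F`. -/
def GVNear {X : Type*} [MetricSpace X] (F : Finset X) (ε : ℝ) : Set (NonemptyCompacts X) :=
  {K | (K : Set X) ⊆ ⋃ x ∈ F, Metric.ball x ε} ∩
    ⋂ x ∈ F, {K | ((K : Set X) ∩ Metric.ball x ε).Nonempty}

/-- `(F', ε')` is a balanced refinement of `(F, ε)`. -/
def GVExt {X : Type*} [MetricSpace X] (F : Finset X) (ε : ℝ) (F' : Finset X) (ε' : ℝ) : Prop :=
  (∀ y ∈ F', ∃ x ∈ F, dist y x + ε' ≤ ε) ∧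
    ∃ M : ℕ, 2 ≤ M ∧ ∀ x ∈ F, (F'.filter (fun y => dist y x < ε)).card = M

lemma GVNear_isOpen {X : Type*} [MetricSpace X] (F : Finset X) (ε : ℝ) :
    IsOpen (GVNear F ε) := by
  unfold GVNear
  refine IsOpen.inter ?_ ?_
  · exact NonemptyCompacts.isOpen_subsets_of_isOpen
      (isOpen_biUnion fun x _ => Metric.isOpen_ball)
  · exact isOpen_biInter_finset fun x _ =>
      NonemptyCompacts.isOpen_inter_nonempty_of_isOpen Metric.isOpen_ball

lemma GV_exists_eps {X : Type*} [MetricSpace X] (F : Finset X) (ε : ℝ) (F' : Finset X)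
    (h : ∀ y ∈ F', ∃ x ∈ F, dist y x < ε) :
    ∃ q : ℚ, GVGood F' (q : ℝ) ∧ ∀ y ∈ F', ∃ x ∈ F, dist y x + (q : ℝ) ≤ ε := by
  have h1 : ∀ᶠ t : ℝ in nhdsWithin 0 (Set.Ioi 0),
      ∀ y ∈ F', ∃ x ∈ F, dist y x + t ≤ ε := by
    rw [Filter.eventually_all_finset]
    intro y hy
    obtain ⟨x, hx, hxy⟩ := h y hy
    have : ∀ᶠ t : ℝ in nhds 0, t < ε - dist y x := gt_mem_nhds (by linarith)
    filter_upwards [nhdsWithin_le_nhds this] with t ht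
    exact ⟨x, hx, by linarith⟩
  have h2 : ∀ᶠ t : ℝ in nhdsWithin 0 (Set.Ioi 0),
      ∀ x ∈ F', ∀ y ∈ F', x ≠ y → 5 * t ≤ dist x y := by
    rw [Filter.eventually_all_finset]
    intro x hx
    rw [Filter.eventually_all_finset]
    intro y hy
    by_cases hxy : x = y
    · simp [hxy]
    have : ∀ᶠ t : ℝ in nhds 0, t < dist x y / 5 :=
      gt_mem_nhds (by have := dist_pos.2 hxy; linarith)
    filter_upwards [nhdsWithin_le_nhds this] with t ht _
    linarith
  have h3 := h1.and h2
  rw [eventually_nhdsWithin_iff, Metric.eventually_nhds_iff] at h3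
  obtain ⟨r, hr, h3⟩ := h3
  obtain ⟨q, hq0, hqr⟩ := exists_rat_btwn hr
  have := h3 (y := (q : ℝ)) (by rw [Real.dist_eq, sub_zero, abs_of_pos hq0]; exact hqr) hq0
  exact ⟨q, ⟨hq0, this.2⟩, this.1⟩

lemma GV_dense {X : Type*} [MetricSpace X]
    (hperf : ∀ x : X, (nhdsWithin x {x}ᶜ).NeBot) {D : Set X} (hD : Dense D)
    (F : Finset X) (ε : ℝ) (hg : GVGood F ε) (K : NonemptyCompacts X) (hK : K ∈ GVNear F ε)
    (η : ℝ) (hη : 0 < η) :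
    ∃ (F' : Finset X) (q : ℚ), (F' : Set X) ⊆ D ∧ GVGood F' (q : ℝ) ∧ GVExt F ε F' q ∧
      ∃ L ∈ GVNear F' (q : ℝ), dist L K ≤ η := by
  classical
  obtain ⟨hK1, hK2⟩ := hK
  simp only [mem_iInter, mem_ofPred_eq] at hK1 hK2
  obtain ⟨hε, hsep⟩ := hg
  set O : Set X := Metric.thickening η (K : Set X) ∩ ⋃ x ∈ F, Metric.ball x ε with hO
  have hOo : IsOpen O :=
    Metric.isOpen_thickening.inter (isOpen_biUnion fun x _ => Metric.isOpen_ball)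
  have hKO : (K : Set X) ⊆ O := fun y hy => ⟨Metric.self_subset_thickening hη _ hy, hK1 hy⟩
  have hcov : (K : Set X) ⊆ ⋃ d : ↥(D ∩ O), Metric.ball (d : X) η := by
    intro y hy
    have hopen : IsOpen (O ∩ Metric.ball y η) := hOo.inter Metric.isOpen_ball
    obtain ⟨d, hd, hdD⟩ := hD.inter_open_nonempty _ hopen
      ⟨y, hKO hy, Metric.mem_ball_self hη⟩
    exact mem_iUnion.2 ⟨⟨d, hdD, hd.1⟩, by
      have := hd.2
      rw [Metric.mem_ball, dist_comm] at this
      exact this⟩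
  obtain ⟨A0, hA0⟩ := K.isCompact.elim_finite_subcover _ (fun d => Metric.isOpen_ball) hcov
  set A : Finset X := A0.image Subtype.val with hA
  have hAD : ∀ a ∈ A, a ∈ D ∩ O := by
    intro a ha
    simp only [hA, Finset.mem_image] at ha
    obtain ⟨b, -, rfl⟩ := ha
    exact b.2
  have hAK : ∀ y ∈ K, ∃ a ∈ A, dist y a < η := by
    intro y hy
    obtain ⟨d, hd, hyd⟩ := mem_iUnion₂.1 (hA0 hy)
    exact ⟨d, Finset.mem_image_of_mem _ hd, hyd⟩
  set M := max 2 A.card with hM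
  have hB : ∀ x ∈ F, ∃ B : Finset X, A.filter (fun y => dist y x < ε) ⊆ B ∧
      (B : Set X) ⊆ D ∩ (O ∩ Metric.ball x ε) ∧ B.card = M := by
    intro x hx
    have hopen : IsOpen (O ∩ Metric.ball x ε) := hOo.inter Metric.isOpen_ball
    have hne : (O ∩ Metric.ball x ε).Nonempty := by
      obtain ⟨y, hy, hyx⟩ := hK2 x hx
      exact ⟨y, hKO hy, hyx⟩
    have hinf : (D ∩ (O ∩ Metric.ball x ε)).Infinite := by
      intro hfin
      have hd : Dense (D \ (D ∩ (O ∩ Metric.ball x ε))) := by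
        have := hperf
        exact hD.sdiff_finite hfin
      obtain ⟨z, hz, hzD⟩ := hd.inter_open_nonempty _ hopen hne
      exact hzD.2 ⟨hzD.1, hz⟩
    have hsub : ((A.filter (fun y => dist y x < ε) : Finset X) : Set X) ⊆
        D ∩ (O ∩ Metric.ball x ε) := by
      intro y hy
      simp only [Finset.coe_filter, mem_ofPred_eq] at hy
      exact ⟨(hAD y hy.1).1, (hAD y hy.1).2, hy.2⟩
    obtain ⟨B, hB1, hB2, hB3⟩ := hinf.exists_superset_ncard_eq hsub (Finset.finite_toSet _)
      (k := M) (by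
        rw [Set.ncard_coe_finset]
        exact (Finset.card_filter_le _ _).trans (le_max_right _ _))
    have hBf : B.Finite := Set.finite_of_ncard_ne_zero (by omega)
    refine ⟨hBf.toFinset, ?_, ?_, ?_⟩
    · intro y hy
      rw [Set.Finite.mem_toFinset]
      exact hB1 hy
    · simpa using hB2
    · rw [← hB3, Set.ncard_eq_toFinset_card _ hBf]
  choose! B hB1 hB2 hB3 using hB
  set F' : Finset X := F.biUnion B with hF'
  have hF'mem : ∀ y ∈ F', ∃ x ∈ F, y ∈ B x := by
    intro y hy
    simpa [hF'] using hy
  have hF'1 : ∀ y ∈ F', ∃ x ∈ F, dist y x < ε := by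
    intro y hy
    obtain ⟨x, hx, hyx⟩ := hF'mem y hy
    exact ⟨x, hx, (hB2 x hx hyx).2.2⟩
  have hAF' : A ⊆ F' := by
    intro a ha
    obtain ⟨x, hx, hax⟩ := mem_iUnion₂.1 (hAD a ha).2.2
    exact Finset.mem_biUnion.2 ⟨x, hx, hB1 x hx (Finset.mem_filter.2 ⟨ha, hax⟩)⟩
  obtain ⟨q, hq1, hq2⟩ := GV_exists_eps F ε F' hF'1
  refine ⟨F', q, ?_, hq1, ⟨hq2, M, le_max_left _ _, ?_⟩, ?_⟩
  · intro y hy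
    obtain ⟨x, hx, hyx⟩ := hF'mem y hy
    exact (hB2 x hx hyx).1
  · intro x hx
    rw [← hB3 x hx]
    congr 1
    ext y
    rw [Finset.mem_filter]
    constructor
    · rintro ⟨hy, hyx⟩
      obtain ⟨z, hz, hyz⟩ := hF'mem y hy
      have h1 : dist y z < ε := (hB2 z hz hyz).2.2
      by_cases hxz : x = z
      · rwa [hxz]
      · have h2 := hsep x hx z hz hxz
        have h3 := dist_triangle_left x z y
        linarith
    · intro hy
      exact ⟨Finset.mem_biUnion.2 ⟨x, hx, hy⟩, (hB2 x hx hy).2.2⟩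
  · obtain ⟨k, hk⟩ := K.nonempty
    obtain ⟨a, ha, -⟩ := hAK k hk
    refine ⟨⟨⟨(F' : Set X), F'.finite_toSet.isCompact⟩, ⟨a, hAF' ha⟩⟩, ⟨?_, ?_⟩, ?_⟩
    · intro y hy
      exact mem_iUnion₂.2 ⟨y, hy, Metric.mem_ball_self hq1.1⟩
    · simp only [mem_iInter, mem_ofPred_eq]
      intro x hx
      exact ⟨x, hx, Metric.mem_ball_self hq1.1⟩
    · rw [Metric.NonemptyCompacts.dist_eq]
      refine Metric.hausdorffDist_le_of_mem_dist hη.le ?_ ?_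
      · intro y hy
        obtain ⟨x, hx, hyx⟩ := hF'mem y hy
        obtain ⟨z, hz, hyz⟩ := Metric.mem_thickening_iff.1 (hB2 x hx hyx).2.1.1
        exact ⟨z, hz, hyz.le⟩
      · intro y hy
        obtain ⟨a, ha, hya⟩ := hAK y hy
        exact ⟨a, hAF' ha, hya.le⟩

lemma GV_dense_union {Y : Type*} [TopologicalSpace Y] {U V : Set Y}
    (h : U ⊆ closure V) : Dense (V ∪ (closure U)ᶜ) := by
  intro y
  by_cases hy : y ∈ closure U
  · exact closure_mono subset_union_left (closure_minimal h isClosed_closure hy)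
  · exact subset_closure (Or.inr hy)

/-- Generic compact sets have the extension property. -/
lemma GV_residual {X : Type*} [MetricSpace X]
    (hperf : ∀ x : X, (nhdsWithin x {x}ᶜ).NeBot) {D : Set X} (hD : Dense D)
    (hDc : D.Countable) :
    ∀ᶠ K in residual (NonemptyCompacts X),
      ∀ (F : Finset X) (q : ℚ), (F : Set X) ⊆ D → GVGood F (q : ℝ) → K ∈ GVNear F (q : ℝ) →
        ∃ (F' : Finset X) (q' : ℚ), (F' : Set X) ⊆ D ∧ GVGood F' (q' : ℝ) ∧
          GVExt F q F' q' ∧ K ∈ GVNear F' (q' : ℝ) := by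
  classical
  have : Countable D := hDc.to_subtype
  have key : ∀ᶠ K in residual (NonemptyCompacts X), ∀ (i : Finset D × ℚ),
      GVGood (i.1.map (Function.Embedding.subtype _)) (i.2 : ℝ) →
      K ∈ GVNear (i.1.map (Function.Embedding.subtype _)) (i.2 : ℝ) →
        ∃ (F' : Finset X) (q' : ℚ), (F' : Set X) ⊆ D ∧ GVGood F' (q' : ℝ) ∧
          GVExt (i.1.map (Function.Embedding.subtype _)) i.2 F' q' ∧
            K ∈ GVNear F' (q' : ℝ) := by
    rw [eventually_countable_forall]
    rintro ⟨F0, q⟩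
    set F : Finset X := F0.map (Function.Embedding.subtype _) with hF
    by_cases hg : GVGood F (q : ℝ)
    swap
    · exact Eventually.of_forall fun K h => absurd h hg
    set V : Set (NonemptyCompacts X) :=
      ⋃ (F' : Finset X) (q' : ℚ) (_ : (F' : Set X) ⊆ D ∧ GVGood F' (q' : ℝ) ∧
        GVExt F q F' q'), GVNear F' (q' : ℝ) with hV
    have hVo : IsOpen V := isOpen_iUnion fun F' => isOpen_iUnion fun q' => isOpen_iUnion fun _ =>
      GVNear_isOpen _ _
    have hUV : GVNear F (q : ℝ) ⊆ closure V := by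
      intro K hK
      rw [Metric.mem_closure_iff]
      intro r hr
      obtain ⟨F', q', h1, h2, h3, L, hL, hLK⟩ :=
        GV_dense hperf hD F q hg K hK (r / 2) (half_pos hr)
      refine ⟨L, ?_, by rw [dist_comm]; linarith⟩
      simp only [hV, mem_iUnion]
      exact ⟨F', q', ⟨h1, h2, h3⟩, hL⟩
    have := residual_of_dense_open (hVo.union isClosed_closure.isOpen_compl)
      (GV_dense_union hUV)
    filter_upwards [this] with K hK _ hKF
    rcases hK with hK | hK
    · simp only [hV, mem_iUnion] at hK
      obtain ⟨F', q', ⟨h1, h2, h3⟩, hL⟩ := hK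
      exact ⟨F', q', h1, h2, h3, hL⟩
    · exact absurd (subset_closure hKF) hK
  filter_upwards [key] with K hK F q hFD hg hKF
  have hFe : F = (F.subtype (· ∈ D)).map (Function.Embedding.subtype _) := by
    rw [Finset.subtype_map_of_mem]
    exact fun x hx => hFD hx
  have := hK ⟨F.subtype (· ∈ D), q⟩
  simp only at this
  rw [← hFe] at this
  exact this hg hKF

/-- Ramp function. -/
noncomputable def GVramp (e t : ℝ) : ℝ := min 1 (max 0 (t / e - 2))

lemma GV_gauge_real (ε b : ℕ → ℝ) (hε : ∀ k, 0 < ε k) (hεa : Antitone ε)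
    (hε0 : Tendsto ε atTop (nhds 0)) (hb : ∀ k, 0 < b k) (hba : Antitone b)
    (hb0 : Tendsto b atTop (nhds 0)) :
    ∃ g : ℝ → ℝ, Continuous g ∧ Monotone g ∧ g 0 = 0 ∧ (∀ t, 0 < t → 0 < g t) ∧
      (∀ k, g (2 * ε k) ≤ b k) ∧ ∀ k t, 3 * ε (k + 1) ≤ t → b k ≤ g t := by
  set a : ℕ → ℝ := fun k => b k - b (k + 1) with ha
  have ha0 : ∀ k, 0 ≤ a k := fun k => sub_nonneg.2 (hba (Nat.le_succ k))
  have htail : ∀ k, HasSum (fun j => a (j + k)) (b k) := by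
    intro k
    rw [hasSum_iff_tendsto_nat_of_nonneg (fun j => ha0 _)]
    have : ∀ n, ∑ i ∈ Finset.range n, a (i + k) = b k - b (n + k) := by
      intro n
      induction n with
      | zero => simp
      | succ n ih =>
        rw [Finset.sum_range_succ, ih]
        simp only [ha]
        rw [show n + 1 + k = n + k + 1 by ring]
        ring
    simp only [this]
    have h2 : Tendsto (fun n => b (n + k)) atTop (nhds 0) := (tendsto_add_atTop_iff_nat k).2 hb0
    simpa using h2.const_sub (b k)
  have hsum : Summable a := by simpa using (htail 0).summable
  have r0 : ∀ e t, 0 ≤ GVramp e t := fun e t => le_min zero_le_one (le_max_left _ _)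
  have r1 : ∀ e t, GVramp e t ≤ 1 := fun e t => min_le_left _ _
  have hle : ∀ k t, a k * GVramp (ε (k + 1)) t ≤ a k := fun k t =>
    mul_le_of_le_one_right (ha0 k) (r1 _ _)
  have hnn : ∀ k t, 0 ≤ a k * GVramp (ε (k + 1)) t := fun k t => mul_nonneg (ha0 k) (r0 _ _)
  have hs : ∀ t, Summable (fun k => a k * GVramp (ε (k + 1)) t) := fun t =>
    Summable.of_nonneg_of_le (fun k => hnn k t) (fun k => hle k t) hsum
  have rz : ∀ k t, t ≤ 2 * ε k → GVramp (ε k) t = 0 := by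
    intro k t ht
    unfold GVramp
    have : t / ε k ≤ 2 := (div_le_iff₀ (hε k)).2 ht
    rw [max_eq_left (by linarith)]
    simp
  have ro : ∀ k t, 3 * ε k ≤ t → GVramp (ε k) t = 1 := by
    intro k t ht
    unfold GVramp
    have : 3 ≤ t / ε k := (le_div_iff₀ (hε k)).2 ht
    exact min_eq_left (le_max_of_le_right (by linarith))
  have hbig : ∀ k t, 3 * ε (k + 1) ≤ t → b k ≤ ∑' k, a k * GVramp (ε (k + 1)) t := by
    intro k t ht
    rw [← (hs t).sum_add_tsum_nat_add k]
    have h1 : 0 ≤ ∑ i ∈ Finset.range k, a i * GVramp (ε (i + 1)) t :=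
      Finset.sum_nonneg fun i _ => hnn i t
    have h2 : ∑' i, a (i + k) * GVramp (ε (i + k + 1)) t = b k := by
      rw [← (htail k).tsum_eq]
      refine tsum_congr fun i => ?_
      rw [ro, mul_one]
      have := hεa (show k + 1 ≤ i + k + 1 by omega)
      linarith
    linarith
  refine ⟨fun t => ∑' k, a k * GVramp (ε (k + 1)) t, ?_, ?_, ?_, ?_, ?_, hbig⟩
  · refine continuous_tsum (u := a) ?_ hsum ?_
    · intro k
      unfold GVramp
      fun_prop
    · intro k t
      rw [Real.norm_eq_abs, abs_of_nonneg (hnn k t)]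
      exact hle k t
  · intro s t hst
    refine (hs s).tsum_le_tsum (fun k => ?_) (hs t)
    refine mul_le_mul_of_nonneg_left ?_ (ha0 k)
    unfold GVramp
    have := div_le_div_of_nonneg_right hst (hε (k + 1)).le
    exact min_le_min le_rfl (max_le_max le_rfl (by linarith))
  · have : ∀ k, a k * GVramp (ε (k + 1)) 0 = 0 := by
      intro k
      rw [rz _ _ (by have := hε (k + 1); positivity), mul_zero]
    simp [this]
  · intro t ht
    obtain ⟨k, hk⟩ := ((tendsto_add_atTop_iff_nat 1).2 hε0 |>.eventually
      (gt_mem_nhds (show (0 : ℝ) < t / 3 by positivity))).exists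
    exact (hb k).trans_le (hbig k t (by linarith))
  · intro k
    simp only
    rw [← (hs _).sum_add_tsum_nat_add k]
    have h1 : ∑ i ∈ Finset.range k, a i * GVramp (ε (i + 1)) (2 * ε k) = 0 := by
      refine Finset.sum_eq_zero fun i hi => ?_
      rw [rz, mul_zero]
      have := hεa (show i + 1 ≤ k by simpa using hi)
      linarith
    rw [h1, zero_add, ← (htail k).tsum_eq]
    exact ((summable_nat_add_iff k).2 (hs _)).tsum_le_tsum (fun i => hle _ _) (htail k).summable

/-- The gauge, in extended nonnegative reals. -/
lemma GV_gauge (ε b : ℕ → ℝ) (hε : ∀ k, 0 < ε k) (hεa : Antitone ε)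
    (hε0 : Tendsto ε atTop (nhds 0)) (hb : ∀ k, 0 < b k) (hba : Antitone b)
    (hb0 : Tendsto b atTop (nhds 0)) :
    ∃ h : ENNReal → ENNReal, IsContinuousGauge h ∧ Continuous h ∧
      (∀ k, h (ENNReal.ofReal (2 * ε k)) ≤ ENNReal.ofReal (b k)) ∧
      ∀ k (t : ENNReal), ENNReal.ofReal (3 * ε (k + 1)) ≤ t → ENNReal.ofReal (b k) ≤ h t := by
  obtain ⟨g, gc, gm, g0, gp, gle, gge⟩ := GV_gauge_real ε b hε hεa hε0 hb hba hb0
  set T : ENNReal := ENNReal.ofReal (3 * ε 0) with hT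
  have hTtop : T ≠ ⊤ := ENNReal.ofReal_ne_top
  have hT0 : 0 < T := ENNReal.ofReal_pos.2 (by have := hε 0; positivity)
  have hmt : ∀ x, min x T ≠ ⊤ := fun x => ne_top_of_le_ne_top hTtop (min_le_right _ _)
  have hc : Continuous fun x : ENNReal => ENNReal.ofReal (g (min x T).toReal) := by
    refine ENNReal.continuous_ofReal.comp (gc.comp ?_)
    exact ENNReal.continuousOn_toReal.comp_continuous (continuous_id.min continuous_const) hmt
  have hm : Monotone fun x : ENNReal => ENNReal.ofReal (g (min x T).toReal) := by
    intro x y hxy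
    exact ENNReal.ofReal_le_ofReal (gm (ENNReal.toReal_mono (hmt y) (min_le_min hxy le_rfl)))
  refine ⟨_, ⟨⟨hm, ?_, fun x => hc.continuousWithinAt⟩, hc.continuousOn⟩, hc, ?_, ?_⟩
  · intro x
    constructor
    · intro hx
      by_contra hne
      have : 0 < (min x T).toReal :=
        ENNReal.toReal_pos (lt_min (pos_iff_ne_zero.2 hne) hT0).ne' (hmt x)
      exact absurd hx (ENNReal.ofReal_pos.2 (gp _ this)).ne'
    · rintro rfl
      simp [g0]
  · intro k
    have h1 := hε k
    have : (ENNReal.ofReal (2 * ε k)) ≤ T :=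
      ENNReal.ofReal_le_ofReal (by have := hεa (Nat.zero_le k); linarith)
    rw [min_eq_left this, ENNReal.toReal_ofReal (by positivity)]
    exact ENNReal.ofReal_le_ofReal (gle k)
  · intro k t ht
    have h1 := hε (k + 1)
    refine ENNReal.ofReal_le_ofReal (gge k _ ?_)
    have : ENNReal.ofReal (3 * ε (k + 1)) ≤ min t T :=
      le_min ht (ENNReal.ofReal_le_ofReal (by have := hεa (Nat.zero_le (k + 1)); linarith))
    have h2 := ENNReal.toReal_mono (hmt t) this
    rwa [ENNReal.toReal_ofReal (by positivity)] at h2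

open Classical in
/-- Number of clusters met by `V`. -/
noncomputable def GVcnt {X : Type*} [MetricSpace X] (F : Finset X) (ε : ℝ) (V : Set X) : ℕ :=
  (F.filter (fun y => (Metric.ball y ε ∩ V).Nonempty)).card

lemma GVcnt_le_one {X : Type*} [MetricSpace X] (F : Finset X) (ε : ℝ) (hg : GVGood F ε)
    (V : Set X) (hV : Metric.ediam V ≤ ENNReal.ofReal (3 * ε)) : GVcnt F ε V ≤ 1 := by
  classical
  unfold GVcnt
  rw [Finset.card_le_one]
  intro y hy z hz
  rw [Finset.mem_filter] at hy hz
  by_contra hne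
  obtain ⟨hy, p, hpy, hpV⟩ := hy
  obtain ⟨hz, q, hqz, hqV⟩ := hz
  have h1 := hg.2 y hy z hz hne
  have h2 : edist p q ≤ ENNReal.ofReal (3 * ε) := (Metric.edist_le_ediam_of_mem hpV hqV).trans hV
  rw [edist_le_ofReal (by have := hg.1; positivity)] at h2
  rw [Metric.mem_ball] at hpy hqz
  have h3 := dist_triangle4 y p q z
  rw [dist_comm y p] at h3
  linarith

lemma GV_card_ge {X : Type*} [MetricSpace X] {F F' : Finset X} {ε : ℝ} (hg : GVGood F ε)
    {M : ℕ} (hM : ∀ x ∈ F, (F'.filter (fun y => dist y x < ε)).card = M) :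
    M * F.card ≤ F'.card := by
  classical
  have hd : (F : Set X).PairwiseDisjoint (fun x => F'.filter (fun y => dist y x < ε)) := by
    intro x hx z hz hxz
    rw [Function.onFun, Finset.disjoint_left]
    intro y hy hy'
    rw [Finset.mem_filter] at hy hy'
    have h1 := hg.2 x hx z hz hxz
    have h2 := dist_triangle_left x z y
    have h3 := hg.1
    linarith [hy.2, hy'.2]
  calc M * F.card = ∑ x ∈ F, (F'.filter (fun y => dist y x < ε)).card := by
        rw [Finset.sum_congr rfl hM, Finset.sum_const, smul_eq_mul, mul_comm]
    _ = (F.biUnion (fun x => F'.filter (fun y => dist y x < ε))).card :=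
        (Finset.card_biUnion hd).symm
    _ ≤ F'.card := Finset.card_le_card (by
        intro y hy
        obtain ⟨x, -, hy⟩ := Finset.mem_biUnion.1 hy
        exact (Finset.mem_filter.1 hy).1)

lemma GVcnt_step {X : Type*} [MetricSpace X] {F F' : Finset X} {ε ε' : ℝ}
    (hε' : 0 < ε')
    (h1 : ∀ y ∈ F', ∃ x ∈ F, dist y x + ε' ≤ ε)
    {M : ℕ} (hM : ∀ x ∈ F, (F'.filter (fun y => dist y x < ε)).card = M) (V : Set X) :
    GVcnt F' ε' V ≤ M * GVcnt F ε V := by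
  classical
  unfold GVcnt
  choose! f hf1 hf2 using h1
  refine Finset.card_le_mul_card_image_of_maps_to (f := f) ?_ M ?_
  · intro y hy
    rw [Finset.mem_filter] at hy ⊢
    obtain ⟨hy, p, hp, hpV⟩ := hy
    exact ⟨hf1 y hy, p, Metric.ball_subset_ball' (by linarith [hf2 y hy]) hp, hpV⟩
  · intro x hx
    rw [Finset.mem_filter] at hx
    rw [← hM x hx.1]
    refine Finset.card_le_card ?_
    intro y hy
    rw [Finset.mem_filter, Finset.mem_filter] at hy
    obtain ⟨⟨hy, -⟩, rfl⟩ := hy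
    exact Finset.mem_filter.2 ⟨hy, by linarith [hf2 y hy]⟩

lemma GV_eps_half {X : Type*} [MetricSpace X] {F F' : Finset X} {ε ε' : ℝ}
    (hne : F.Nonempty) (hg' : GVGood F' ε') (he : GVExt F ε F' ε') : ε' ≤ ε / 2 := by
  obtain ⟨-, M, hM2, hM⟩ := he
  obtain ⟨x, hx⟩ := hne
  have h1 : 1 < (F'.filter (fun y => dist y x < ε)).card := by rw [hM x hx]; omega
  obtain ⟨y, hy, z, hz, hyz⟩ := Finset.one_lt_card.1 h1
  rw [Finset.mem_filter] at hy hz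
  have h2 := hg'.2 y hy.1 z hz.1 hyz
  have h3 := dist_triangle_right y z x
  have h4 := hg'.1
  linarith [hy.2, hz.2]

lemma GVcnt_ratio {X : Type*} [MetricSpace X] (F : ℕ → Finset X) (ε : ℕ → ℝ)
    (hg : ∀ k, GVGood (F k) (ε k)) (he : ∀ k, GVExt (F k) (ε k) (F (k + 1)) (ε (k + 1)))
    (V : Set X) (j : ℕ) (hV : Metric.ediam V ≤ ENNReal.ofReal (3 * ε j)) (k : ℕ) (hjk : j ≤ k) :
    GVcnt (F k) (ε k) V * (F j).card ≤ (F k).card := by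
  induction k, hjk using Nat.le_induction with
  | base =>
    have := GVcnt_le_one _ _ (hg j) V hV
    nlinarith
  | succ k hjk ih =>
    obtain ⟨h1, M, hM2, hM⟩ := he k
    have h2 := GVcnt_step (hg (k + 1)).1 h1 hM V
    have h3 := GV_card_ge (hg k) hM
    calc GVcnt (F (k + 1)) (ε (k + 1)) V * (F j).card
        ≤ (M * GVcnt (F k) (ε k) V) * (F j).card := Nat.mul_le_mul_right _ h2
      _ = M * (GVcnt (F k) (ε k) V * (F j).card) := by ring
      _ ≤ M * (F k).card := Nat.mul_le_mul_left _ ih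
      _ ≤ _ := h3

/-- The measure estimate. -/
lemma GV_measure {X : Type*} [MetricSpace X] [MeasurableSpace X] [BorelSpace X]
    (K : NonemptyCompacts X) (F : ℕ → Finset X) (ε : ℕ → ℝ)
    (hg : ∀ k, GVGood (F k) (ε k)) (he : ∀ k, GVExt (F k) (ε k) (F (k + 1)) (ε (k + 1)))
    (hK : ∀ k, K ∈ GVNear (F k) (ε k)) :
    ∃ h : ENNReal → ENNReal, IsContinuousGauge h ∧
          0 < Measure.mkMetric h (K : Set X) ∧ Measure.mkMetric h (K : Set X) < ⊤ := by
  classical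
  have hε : ∀ k, 0 < ε k := fun k => (hg k).1
  have hcov : ∀ k, (K : Set X) ⊆ ⋃ x ∈ F k, Metric.ball x (ε k) := fun k => (hK k).1
  have hmeet : ∀ k, ∀ x ∈ F k, ((K : Set X) ∩ Metric.ball x (ε k)).Nonempty := by
    intro k x hx
    have := (hK k).2
    simp only [mem_iInter, mem_ofPred_eq] at this
    exact this x hx
  have hne : ∀ k, (F k).Nonempty := by
    intro k
    obtain ⟨y, hy⟩ := K.nonempty
    obtain ⟨x, hx, -⟩ := mem_iUnion₂.1 (hcov k hy)
    exact ⟨x, hx⟩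
  have hhalf : ∀ k, ε (k + 1) ≤ ε k / 2 := fun k => GV_eps_half (hne k) (hg (k + 1)) (he k)
  have hεa : Antitone ε := antitone_nat_of_succ_le fun k => by linarith [hhalf k, hε k]
  have hεb : ∀ k, ε k ≤ ε 0 * (1 / 2) ^ k := by
    intro k
    induction k with
    | zero => simp
    | succ k ih => rw [pow_succ]; linarith [hhalf k]
  have hpow : Tendsto (fun k : ℕ => (1 / 2 : ℝ) ^ k) atTop (nhds 0) :=
    tendsto_pow_atTop_nhds_zero_of_lt_one (by norm_num) (by norm_num)
  have hε0 : Tendsto ε atTop (nhds 0) := by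
    refine squeeze_zero (fun k => (hε k).le) hεb ?_
    simpa using hpow.const_mul (ε 0)
  have hNpos : ∀ k, 0 < ((F k).card : ℝ) := fun k => by exact_mod_cast (hne k).card_pos
  have hN : ∀ k, 2 * (F k).card ≤ (F (k + 1)).card := by
    intro k
    obtain ⟨-, M, hM2, hM⟩ := he k
    exact (Nat.mul_le_mul_right _ hM2).trans (GV_card_ge (hg k) hM)
  set b : ℕ → ℝ := fun k => ((F k).card : ℝ)⁻¹ with hbdef
  have hb : ∀ k, 0 < b k := fun k => inv_pos.2 (hNpos k)
  have hbhalf : ∀ k, b (k + 1) ≤ b k / 2 := by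
    intro k
    have h1 : 2 * ((F k).card : ℝ) ≤ (F (k + 1)).card := by exact_mod_cast hN k
    have h2 := inv_anti₀ (by have := hNpos k; positivity) h1
    simp only [hbdef]
    rw [mul_inv] at h2
    linarith
  have hba : Antitone b := antitone_nat_of_succ_le fun k => by linarith [hbhalf k, hb k]
  have hbb : ∀ k, b k ≤ b 0 * (1 / 2) ^ k := by
    intro k
    induction k with
    | zero => simp
    | succ k ih => rw [pow_succ]; linarith [hbhalf k]
  have hb0 : Tendsto b atTop (nhds 0) := by
    refine squeeze_zero (fun k => (hb k).le) hbb ?_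
    simpa using hpow.const_mul (b 0)
  obtain ⟨h, hgauge, hc, hle, hge⟩ := GV_gauge ε b hε hεa hε0 hb hba hb0
  have hmono : Monotone h := hgauge.1.1
  refine ⟨h, hgauge, ?_, ?_⟩
  · -- lower bound
    have hcount : ∀ (V : Set X) (d : ENNReal), Metric.ediam V ≤ d → 0 < d →
        d ≤ ENNReal.ofReal (3 * ε 0) →
        ∀ᶠ k in atTop, (GVcnt (F k) (ε k) V : ENNReal) ≤ (F k).card * h d := by
      intro V d hVd hd0 hd
      have hex : ∃ j, ENNReal.ofReal (3 * ε (j + 1)) ≤ d := by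
        have : Tendsto (fun j => ENNReal.ofReal (3 * ε (j + 1))) atTop (nhds 0) := by
          have h1 : Tendsto (fun j => 3 * ε (j + 1)) atTop (nhds 0) := by
            simpa using ((tendsto_add_atTop_iff_nat 1).2 hε0).const_mul 3
          simpa using ENNReal.tendsto_ofReal h1
        obtain ⟨j, hj⟩ := (this.eventually (gt_mem_nhds hd0)).exists
        exact ⟨j, hj.le⟩
      have hj1 := Nat.find_spec hex
      set j := Nat.find hex with hj
      have hj2 : d ≤ ENNReal.ofReal (3 * ε j) := by
        rcases Nat.eq_zero_or_pos j with h0 | h0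
        · rwa [h0]
        · have := Nat.find_min hex (show j - 1 < Nat.find hex by omega)
          rw [show j - 1 + 1 = j by omega] at this
          exact (not_le.1 this).le
      filter_upwards [eventually_ge_atTop j] with k hk
      have h1 := GVcnt_ratio F ε hg he V j (hVd.trans hj2) k hk
      have h2 : (GVcnt (F k) (ε k) V : ℝ) ≤ (F k).card * b j := by
        have h1' : (GVcnt (F k) (ε k) V : ℝ) * (F j).card ≤ (F k).card := by exact_mod_cast h1
        simp only [hbdef]
        rw [← div_eq_mul_inv, le_div_iff₀ (hNpos j)]
        exact h1'
      calc (GVcnt (F k) (ε k) V : ENNReal)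
          = ENNReal.ofReal (GVcnt (F k) (ε k) V : ℝ) := by simp
        _ ≤ ENNReal.ofReal ((F k).card * b j) := ENNReal.ofReal_le_ofReal h2
        _ = (F k).card * ENNReal.ofReal (b j) := by
            rw [ENNReal.ofReal_mul (by positivity)]; simp
        _ ≤ _ := by gcongr; exact hge j d hj1
    have hR : 0 < ENNReal.ofReal (2 * ε 0) := ENNReal.ofReal_pos.2 (by linarith [hε 0])
    have hR3 : ENNReal.ofReal (2 * ε 0) < ENNReal.ofReal (3 * ε 0) :=
      (ENNReal.ofReal_lt_ofReal_iff (by linarith [hε 0])).2 (by linarith [hε 0])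
    refine lt_of_lt_of_le (show (0 : ENNReal) < 1 from zero_lt_one) ?_
    rw [Measure.mkMetric_apply]
    refine le_iSup₂_of_le (ENNReal.ofReal (2 * ε 0)) hR ?_
    refine le_iInf fun t => le_iInf fun htK => le_iInf fun htd => ?_
    refine ENNReal.le_of_forall_pos_le_add fun η hη _ => ?_
    obtain ⟨η', hη'0, hη's⟩ := ENNReal.exists_pos_sum_of_countable'
      (ε := (η : ENNReal)) (by simpa using hη.ne') ℕ
    have hr : ∀ n, ∃ r : ℝ, 0 < r ∧
        Metric.ediam (t n) + ENNReal.ofReal (2 * r) ≤ ENNReal.ofReal (3 * ε 0) ∧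
        h (Metric.ediam (t n) + ENNReal.ofReal (2 * r)) ≤ h (Metric.ediam (t n)) + η' n := by
      intro n
      have h1 : Tendsto (fun r : ℝ => Metric.ediam (t n) + ENNReal.ofReal (2 * r))
          (nhdsWithin 0 (Set.Ioi 0)) (nhds (Metric.ediam (t n))) := by
        have h2 : Continuous (fun r : ℝ => Metric.ediam (t n) + ENNReal.ofReal (2 * r)) :=
          continuous_const.add (ENNReal.continuous_ofReal.comp (continuous_const.mul continuous_id))
        have := h2.tendsto 0
        simp only [mul_zero, ENNReal.ofReal_zero, add_zero] at this
        exact this.mono_left nhdsWithin_le_nhds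
      have h3 : ∀ᶠ r : ℝ in nhdsWithin 0 (Set.Ioi 0),
          Metric.ediam (t n) + ENNReal.ofReal (2 * r) < ENNReal.ofReal (3 * ε 0) :=
        h1.eventually (gt_mem_nhds ((htd n).trans_lt hR3))
      have h4 : ∀ᶠ r : ℝ in nhdsWithin 0 (Set.Ioi 0),
          h (Metric.ediam (t n) + ENNReal.ofReal (2 * r)) ≤ h (Metric.ediam (t n)) + η' n := by
        have h5 := (hc.tendsto _).comp h1
        by_cases htop : h (Metric.ediam (t n)) = ⊤
        · simp [htop]
        · exact (h5.eventually (gt_mem_nhds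
            (ENNReal.lt_add_right htop (hη'0 n).ne'))).mono fun r hr => hr.le
      obtain ⟨r, ⟨hr1, hr2⟩, hr3⟩ := ((h3.and h4).and self_mem_nhdsWithin).exists
      exact ⟨r, hr3, hr1.le, hr2⟩
    choose r hr0 hr1 hr2 using hr
    have hcovV : (K : Set X) ⊆ ⋃ n, Metric.thickening (r n) (t n) :=
      htK.trans (iUnion_mono fun n => Metric.self_subset_thickening (hr0 n) _)
    obtain ⟨I, hI⟩ := K.isCompact.elim_finite_subcover _
      (fun n => Metric.isOpen_thickening) hcovV
    have hVcount : ∀ n, ∀ᶠ k in atTop,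
        (GVcnt (F k) (ε k) (Metric.thickening (r n) (t n)) : ENNReal) ≤
          (F k).card * ((⨆ _ : (t n).Nonempty, h (Metric.ediam (t n))) + η' n) := by
      intro n
      rcases (t n).eq_empty_or_nonempty with h0 | h0
      · simp [h0, GVcnt]
      · have hdiam : Metric.ediam (Metric.thickening (r n) (t n)) ≤
            Metric.ediam (t n) + ENNReal.ofReal (2 * r n) := by
          have := Metric.ediam_thickening_le (s := t n) (r n).toNNReal
          rw [Real.coe_toNNReal _ (hr0 n).le] at this
          refine this.trans (le_of_eq ?_)
          rw [ENNReal.ofReal_mul (by norm_num)]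
          congr 2
          simp
        filter_upwards [hcount _ _ hdiam (lt_of_lt_of_le (ENNReal.ofReal_pos.2
          (by linarith [hr0 n])) le_add_self) (hr1 n)] with k hk
        refine hk.trans ?_
        rw [iSup_pos h0]
        gcongr
        exact hr2 n
    obtain ⟨k, hk⟩ := ((Filter.eventually_all_finset I).2 fun n _ => hVcount n).exists
    have hsub : F k ⊆ I.biUnion (fun n => (F k).filter
        (fun y => (Metric.ball y (ε k) ∩ Metric.thickening (r n) (t n)).Nonempty)) := by
      intro x hx
      obtain ⟨p, hpK, hpx⟩ := hmeet k x hx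
      obtain ⟨n, hn, hpn⟩ := mem_iUnion₂.1 (hI hpK)
      exact Finset.mem_biUnion.2 ⟨n, hn, Finset.mem_filter.2 ⟨hx, p, hpx, hpn⟩⟩
    have hcard : (F k).card ≤
        ∑ n ∈ I, GVcnt (F k) (ε k) (Metric.thickening (r n) (t n)) :=
      (Finset.card_le_card hsub).trans (by
        refine Finset.card_biUnion_le.trans (le_of_eq ?_)
        refine Finset.sum_congr rfl fun n _ => ?_
        unfold GVcnt
        congr)
    have hfin : ((F k).card : ENNReal) * 1 ≤ (F k).card *
        (∑' n, (⨆ _ : (t n).Nonempty, h (Metric.ediam (t n))) + η) := by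
      calc ((F k).card : ENNReal) * 1
          ≤ ∑ n ∈ I, (GVcnt (F k) (ε k) (Metric.thickening (r n) (t n)) : ENNReal) := by
            rw [mul_one]; exact_mod_cast hcard
        _ ≤ ∑ n ∈ I, ((F k).card : ENNReal) *
              ((⨆ _ : (t n).Nonempty, h (Metric.ediam (t n))) + η' n) :=
            Finset.sum_le_sum hk
        _ = (F k).card *
              ∑ n ∈ I, ((⨆ _ : (t n).Nonempty, h (Metric.ediam (t n))) + η' n) := by
            rw [Finset.mul_sum]
        _ ≤ (F k).card *
              ∑' n, ((⨆ _ : (t n).Nonempty, h (Metric.ediam (t n))) + η' n) := by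
            gcongr
            exact ENNReal.sum_le_tsum I
        _ ≤ _ := by
            rw [ENNReal.tsum_add]
            gcongr
    exact (ENNReal.mul_le_mul_iff_right (by exact_mod_cast (hne k).card_pos.ne')
      (ENNReal.natCast_ne_top _)).1 hfin
  · -- upper bound
    have hr : Tendsto (fun k => ENNReal.ofReal (2 * ε k)) atTop (nhds 0) := by
      have h1 : Tendsto (fun j => 2 * ε j) atTop (nhds 0) := by simpa using hε0.const_mul 2
      simpa using ENNReal.tendsto_ofReal h1
    have hdiam : ∀ k (x : X), Metric.ediam (Metric.ball x (ε k)) ≤ ENNReal.ofReal (2 * ε k) := by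
      intro k x
      refine Metric.ediam_le fun p hp q hq => ?_
      rw [edist_le_ofReal (by linarith [hε k])]
      have := dist_triangle_right p q x
      rw [Metric.mem_ball] at hp hq
      linarith
    have h1 := Measure.mkMetric_le_liminf_sum (ι := fun k : ℕ => ↥(F k)) (K : Set X)
      (l := atTop) (fun k => ENNReal.ofReal (2 * ε k)) hr
      (fun k x => Metric.ball (x : X) (ε k))
      (Eventually.of_forall fun k x => hdiam k x)
      (Eventually.of_forall fun k => by
        refine (hcov k).trans ?_
        rw [iUnion_subtype]) h
    refine h1.trans_lt (lt_of_le_of_lt ?_ ENNReal.one_lt_top)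
    have h2 : ∀ k, ∑ x : ↥(F k), h (Metric.ediam (Metric.ball (x : X) (ε k))) ≤ 1 := by
      intro k
      calc ∑ x : ↥(F k), h (Metric.ediam (Metric.ball (x : X) (ε k)))
          ≤ ∑ x : ↥(F k), ENNReal.ofReal (b k) :=
            Finset.sum_le_sum fun x _ => (hmono (hdiam k x)).trans (hle k)
        _ = 1 := by
            simp only [Finset.sum_const, Finset.card_univ, Fintype.card_coe, nsmul_eq_mul]
            rw [← ENNReal.ofReal_natCast, ← ENNReal.ofReal_mul (by positivity)]
            simp only [hbdef]
            rw [mul_inv_cancel₀ (hNpos k).ne', ENNReal.ofReal_one]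
    calc _ ≤ liminf (fun _ : ℕ => (1 : ENNReal)) atTop :=
          liminf_le_liminf (Eventually.of_forall h2)
      _ = 1 := by simp

/-- In a perfect Polish space, the generic non-empty compact set `K` admits a continuous
gauge function `h` with `0 < ℋ^h(K) < ∞`. -/
theorem generic_compact_gauge_visible_of_perfect
    {X : Type*} [MetricSpace X] [CompleteSpace X] [SeparableSpace X]
    [MeasurableSpace X] [BorelSpace X]
    (hperf : ∀ x : X, (nhdsWithin x {x}ᶜ).NeBot) :
    {K : NonemptyCompacts X |
        ∃ h : ENNReal → ENNReal, IsContinuousGauge h ∧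
          0 < Measure.mkMetric h (K : Set X) ∧ Measure.mkMetric h (K : Set X) < ⊤} ∈
      residual (NonemptyCompacts X) := by
  obtain ⟨D, hDc, hD⟩ := TopologicalSpace.exists_countable_dense X
  filter_upwards [GV_residual hperf hD hDc] with K hK
  have hK0 : ∃ c : Finset X × ℚ, (c.1 : Set X) ⊆ D ∧ GVGood c.1 (c.2 : ℝ) ∧
      K ∈ GVNear c.1 (c.2 : ℝ) := by
    obtain ⟨y, hy⟩ := K.nonempty
    obtain ⟨x, hx⟩ : D.Nonempty := by
      have : Nonempty X := ⟨y⟩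
      exact hD.nonempty
    obtain ⟨R, hR⟩ := K.isCompact.isBounded.subset_ball x
    obtain ⟨n, hn⟩ := exists_nat_gt (max R 0)
    have hnR : R < n := (le_max_left _ _).trans_lt hn
    have hn0 : (0 : ℝ) < n := (le_max_right _ _).trans_lt hn
    have hball : ∀ z ∈ (K : Set X), dist z x < n := fun z hz => lt_trans (hR hz) hnR
    refine ⟨⟨{x}, (n : ℚ)⟩, ?_, ⟨?_, ?_⟩, ?_, ?_⟩
    · simpa using hx
    · simpa using hn0
    · intro a ha b hb hab
      simp only [Finset.mem_singleton] at ha hb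
      exact absurd (ha.trans hb.symm) hab
    · intro z hz
      simpa using hball z hz
    · simp only [Finset.mem_singleton, iInter_iInter_eq_left, mem_ofPred_eq]
      exact ⟨y, hy, by simpa using hball y hy⟩
  obtain ⟨c0, hc0⟩ := hK0
  let P : Finset X × ℚ → Prop := fun c => (c.1 : Set X) ⊆ D ∧ GVGood c.1 (c.2 : ℝ) ∧
      K ∈ GVNear c.1 (c.2 : ℝ)
  have hstep : ∀ c : {c // P c}, ∃ c' : {c // P c},
      GVExt c.1.1 (c.1.2 : ℝ) c'.1.1 (c'.1.2 : ℝ) := by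
    rintro ⟨⟨F, q⟩, h1, h2, h3⟩
    obtain ⟨F', q', h4, h5, h6, h7⟩ := hK F q h1 h2 h3
    exact ⟨⟨⟨F', q'⟩, h4, h5, h7⟩, h6⟩
  choose next hnext using hstep
  let c : ℕ → {c // P c} := fun n => next^[n] ⟨c0, hc0⟩
  have hcs : ∀ n, c (n + 1) = next (c n) := fun n => Function.iterate_succ_apply' _ _ _
  refine GV_measure K (fun k => (c k).1.1) (fun k => ((c k).1.2 : ℝ)) (fun k => (c k).2.2.1)
    (fun k => ?_) (fun k => (c k).2.2.2)
  simp only [hcs]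
  exact hnext (c k)
end
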